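/- Mollification on Wasserstein space: (i) for every continuous U : P₂(S) → ℝ there exist Uₙ ∈ C^∞(P₂(S)) with sup_{m∈K} |Uₙ(m) − U(m)| → 0 for every W₂-compact set K ⊂ P₂(S); (ii) for every U : P₁(S) → ℝ continuous under the 1-Wasserstein distance W₁ there exist Uₙ ∈ C^∞(P₂(S)) ∩ C⁰(P₁(S)) with sup_{m∈K} |Uₙ(m) − U(m)| → 0 for every W₁-compact set K ⊂ P₁(S); (iii) if moreover U is Lipschitz continuous under W₁, the Uₙ can be chosen Lipschitz continuous under W₁ uniformly in n. -/

import Mathlib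

open MeasureTheory Filter Topology Matrix

noncomputable section

namespace MFOS

/-- Sequential compactness of a set `A` with respect to an abstract distance function
`dist` : every sequence in `A` admits a subsequence converging, in the distance `dist`,
to a point of `A`. -/
def SeqCompactIn {α : Type*} (dist : α → α → ℝ) (A : Set α) : Prop :=
  ∀ u : ℕ → α, (∀ n, u n ∈ A) →
    ∃ p ∈ A, ∃ φ : ℕ → ℕ, StrictMono φ ∧
      Tendsto (fun n => dist (u (φ n)) p) atTop (𝓝 0)

/-- The state space `S = ℝ^d × N`, where `N = Fin nN` is the finite set of switching
modes. -/
abbrev S (dd nN : ℕ) := (Fin dd → ℝ) × Fin nN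

/-- A natural distance on the state space `S` : Euclidean distance in the `x`-component,
discrete distance in the switching mode. -/
def Sdist {dd nN : ℕ} (y y' : S dd nN) : ℝ :=
  ‖y.1 - y'.1‖ + (if y.2 = y'.2 then 0 else 1)

/-- `m ∈ P₂(S)` : finite second moment. -/
def FiniteSecondMoment {dd nN : ℕ} (m : ProbabilityMeasure (S dd nN)) : Prop :=
  ∫⁻ y, ENNReal.ofReal (‖y.1‖ ^ 2) ∂(m : Measure (S dd nN)) < ⊤

/-- `m ∈ P₁(S)` : finite first moment. -/
def FiniteFirstMoment {dd nN : ℕ} (m : ProbabilityMeasure (S dd nN)) : Prop :=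
  ∫⁻ y, ENNReal.ofReal ‖y.1‖ ∂(m : Measure (S dd nN)) < ⊤

/-- The `p`-Wasserstein distance associated with a cost function `c`, defined through
couplings. -/
def Wp {γ : Type*} [MeasurableSpace γ] (c : γ → γ → ℝ) (p : ℝ)
    (μ ν : ProbabilityMeasure γ) : ℝ :=
  sInf {r | ∃ π : Measure (γ × γ), IsProbabilityMeasure π ∧
    π.map Prod.fst = (μ : Measure γ) ∧ π.map Prod.snd = (ν : Measure γ) ∧
    r = (∫ z, c z.1 z.2 ^ p ∂π) ^ (1 / p)}

/-- The `2`-Wasserstein distance `W₂` on probability measures on `S`. -/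
def W2S {dd nN : ℕ} : ProbabilityMeasure (S dd nN) → ProbabilityMeasure (S dd nN) → ℝ :=
  Wp Sdist 2

/-- The `1`-Wasserstein distance `W₁` on probability measures on `S`. -/
def W1S {dd nN : ℕ} : ProbabilityMeasure (S dd nN) → ProbabilityMeasure (S dd nN) → ℝ :=
  Wp Sdist 1

/-- The component measure `m(dx, i)` on `ℝ^d` of a measure `m` on `S = ℝ^d × N` at the
switching mode `i`. -/
def mComp {dd nN : ℕ} (m : ProbabilityMeasure (S dd nN)) (i : Fin nN) :
    Measure (Fin dd → ℝ) :=
  Measure.map Prod.fst ((m : Measure (S dd nN)).restrict {y | y.2 = i})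

/-- The convex mixture `(1 - a) μ + a ν` of two measures. -/
def mix {γ : Type*} [MeasurableSpace γ] (a : ℝ) (μ ν : Measure γ) : Measure γ :=
  ENNReal.ofReal (1 - a) • μ + ENNReal.ofReal a • ν

/-- The probability `l({q})` of a point `q`. -/
def pt {γ : Type*} [MeasurableSpace γ] (l : ProbabilityMeasure γ) (q : γ) : ℝ :=
  ((l : Measure γ) {q}).toReal

/-- `δ` is the joint linear functional derivative `δ_{l,m} u` of `u(t, ·; ·)` in the
pair of measure variables `(m, l)`. -/
def IsJointLinDeriv {dd nN : ℕ} {M : Type} [Fintype M] [MeasurableSpace M]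
    (u : ℝ → ProbabilityMeasure (S dd nN) → ProbabilityMeasure M → ℝ)
    (δ : ℝ → Measure (S dd nN) → Measure M → S dd nN → M → ℝ) : Prop :=
  ∀ (t : ℝ) (m m' : ProbabilityMeasure (S dd nN)) (l l' : ProbabilityMeasure M),
    u t m' l' - u t m l =
      ∫ a in (0:ℝ)..1, ∑ q,
        ((∫ y, δ t (mix a (m : Measure (S dd nN)) (m' : Measure (S dd nN)))
              (mix a (l : Measure M) (l' : Measure M)) y q ∂(m' : Measure (S dd nN))) -
         (∫ y, δ t (mix a (m : Measure (S dd nN)) (m' : Measure (S dd nN)))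
              (mix a (l : Measure M) (l' : Measure M)) y q ∂(m : Measure (S dd nN)))) *
        (pt l' q - pt l q)

/-- All the data of the regime-switching mean field optimal switching problem on the
canonical (Skorokhod) space `Ω`, together with the standing assumptions
(Assumption 2.1 of the paper). -/
structure Setting (dd nN : ℕ) (M : Type) [Fintype M] [DecidableEq M] [MeasurableSpace M]
    (Ω : Type) [MeasurableSpace Ω] where
  /-- the finite time horizon -/
  T : ℝ
  T_pos : 0 < T
  /-- the `2`-Wasserstein distance on probability measures on the canonical path space -/
  W2path : ProbabilityMeasure Ω → ProbabilityMeasure Ω → ℝ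
  /-- drift coefficient `b(t, q, (x,i), m)` -/
  b : ℝ → M → S dd nN → ProbabilityMeasure (S dd nN) → (Fin dd → ℝ)
  /-- diffusion coefficient `σ(t, q, (x,i), m)`, a nonnegative symmetric `d×d` matrix -/
  σ : ℝ → M → S dd nN → ProbabilityMeasure (S dd nN) → Matrix (Fin dd) (Fin dd) ℝ
  /-- running gain `f(t, q, (x,i), m)` -/
  f : ℝ → M → S dd nN → ProbabilityMeasure (S dd nN) → ℝ
  /-- terminal gain `h(q, (x,i), m)` -/
  h : M → S dd nN → ProbabilityMeasure (S dd nN) → ℝ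
  /-- switching costs `g_{ij}(t, x)` -/
  g : Fin nN → Fin nN → ℝ → (Fin dd → ℝ) → ℝ
  /-- state-dependent generator rates `λ_{pq}(x)` of the Markov chain `α` -/
  lam : M → M → (Fin dd → ℝ) → ℝ
  /-- averaged running gain `F(t, m, l) = Σ_q ∫ f(t,q,y,m) m(dy) l(q)` -/
  Fb : ℝ → ProbabilityMeasure (S dd nN) → ProbabilityMeasure M → ℝ
  /-- averaged terminal gain `H(m, l) = Σ_q ∫ h(q,y,m) m(dy) l(q)` -/
  Hb : ProbabilityMeasure (S dd nN) → ProbabilityMeasure M → ℝ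
  /-- averaged `n`-th switching cost `Gⁿ(t, m)` of (2.6) -/
  G : ℕ → ℝ → ProbabilityMeasure (S dd nN) → ℝ
  /-- `P(t, m; l)` : the set of weak solutions of the regime-switching McKean–Vlasov
  martingale problem started at time `t`, i.e. probability measures `P` on the canonical
  space under which `Y = (X, I)` is constant on `[-1, t)` with `P_{Y_{t-}} = m`, the
  chain `α` has law `l` at `t-` and extended generator `Q(P_{Y_s})` on `[t, T]`, and
  `M_· = X_· - ∫_t^· b(α_r, Y_r, P_{Y_r}) dr` and `N_· = M_·² - ∫_t^· σ²(α_r, Y_r, P_{Y_r}) dr`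
  are `P`-martingales on `[t, T]`. -/
  P : ℝ → ProbabilityMeasure (S dd nN) → ProbabilityMeasure M → Set (ProbabilityMeasure Ω)
  /-- the marginal law `P_{Y_s}` of the canonical process `Y = (X, I)` -/
  Ylaw : ProbabilityMeasure Ω → ℝ → ProbabilityMeasure (S dd nN)
  /-- the left-limit marginal law `P_{Y_{s-}}` -/
  YlawL : ProbabilityMeasure Ω → ℝ → ProbabilityMeasure (S dd nN)
  /-- the marginal law `P_{α_s}` of the canonical Markov chain -/
  alaw : ProbabilityMeasure Ω → ℝ → ProbabilityMeasure M
  /-- the left-limit marginal law `P_{α_{s-}}` -/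
  alawL : ProbabilityMeasure Ω → ℝ → ProbabilityMeasure M
  /-- the running maximum `ω ↦ sup_{0 ≤ s ≤ T} |X_s(ω)|` of the canonical process -/
  runMax : Ω → ℝ
  /-- the total expected switching cost `Σ_{τₙ ≥ t} ∫_t^s Gⁿ(r, P_{Y_r}) dr` on `[t, s]`
  under a path measure `P` -/
  switchCost : ℝ → ℝ → ProbabilityMeasure Ω → ℝ
  /-- the value function `V(t, m; l)` of the mean field optimal switching problem -/
  V : ℝ → ProbabilityMeasure (S dd nN) → ProbabilityMeasure M → ℝ
  /-- the operator `ℚ` of (2.13), acting on functions of `(t, m; l)` -/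
  Qop : (ℝ → ProbabilityMeasure (S dd nN) → ProbabilityMeasure M → ℝ) →
    ℝ → ProbabilityMeasure (S dd nN) → ProbabilityMeasure M → ℝ
  /-- `F` is the average of `f` -/
  Fb_def : ∀ t m l, Fb t m l = ∑ q, pt l q * ∫ y, f t q y m ∂(m : Measure (S dd nN))
  /-- `H` is the average of `h` -/
  Hb_def : ∀ m l, Hb m l = ∑ q, pt l q * ∫ y, h q y m ∂(m : Measure (S dd nN))
  /-- members of `P(t, m; l)` have initial law `m` for `Y` -/
  init_Y : ∀ t m l, ∀ p ∈ P t m l, YlawL p t = m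
  /-- members of `P(t, m; l)` have initial law `l` for `α` -/
  init_alpha : ∀ t m l, ∀ p ∈ P t m l, alawL p t = l
  /-- definition (2.9) of the value function -/
  V_def : ∀ t m l, V t m l = sSup ((fun p => Hb (Ylaw p T) (alaw p T)
    + (∫ r in t..T, Fb r (Ylaw p r) (alaw p r)) - switchCost t T p) '' P t m l)
  /-- `ℚ` is given by the formula of (2.13) on every function admitting a joint linear
  functional derivative -/
  Qop_spec : ∀ u δu, IsJointLinDeriv u δu → ∀ t m l,
    Qop u t m l = ∑ p, pt l p *
      ∫ y, (∑ q ∈ Finset.univ.erase p, lam p q y.1 *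
        (δu t (m : Measure (S dd nN)) (l : Measure M) y q -
         δu t (m : Measure (S dd nN)) (l : Measure M) y p)) ∂(m : Measure (S dd nN))
  /-- a common Lipschitz constant for `b, σ` -/
  lip : ℝ
  lip_nonneg : 0 ≤ lip
  /-- `b` is uniformly Lipschitz continuous in `(x, m)` (Assumption 2.1 (i)) -/
  b_lip : ∀ t q x x' i m m',
    ‖b t q (x, i) m - b t q (x', i) m'‖ ≤ lip * (‖x - x'‖ + W2S m m')
  /-- `σ` is uniformly Lipschitz continuous in `(x, m)` (Assumption 2.1 (i)) -/
  σ_lip : ∀ t q x x' i m m' j k,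
    |σ t q (x, i) m j k - σ t q (x', i) m' j k| ≤ lip * (‖x - x'‖ + W2S m m')
  /-- `b` is continuous in `t` -/
  b_tcont : ∀ q y m, Continuous fun t => b t q y m
  /-- `σ` is continuous in `t` -/
  σ_tcont : ∀ q y m, Continuous fun t => σ t q y m
  /-- off-diagonal rates are nonnegative -/
  lam_nonneg : ∀ p q x, p ≠ q → 0 ≤ lam p q x
  /-- the rows of the generator sum to zero -/
  lam_rowsum : ∀ p x, ∑ q, lam p q x = 0
  /-- the averaged rates `λ_{pq}(m)` of (2.5) are uniformly bounded (Assumption 2.1 (iv)) -/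
  lam_bdd : ∃ C, ∀ p q (m : ProbabilityMeasure (S dd nN)),
    |∫ y, lam p q y.1 ∂(m : Measure (S dd nN))| ≤ C
  /-- quadratic growth of `f` (Assumption 2.1 (ii)) -/
  f_growth : ∃ C, ∀ t q y m, |f t q y m| ≤ C * (1 + ‖y.1‖ ^ 2)
  /-- quadratic growth of `h` (Assumption 2.1 (iii)) -/
  h_growth : ∃ C, ∀ q y m, |h q y m| ≤ C * (1 + ‖y.1‖ ^ 2)
  /-- quadratic growth of `g` (Assumption 2.1 (v)) -/
  g_growth : ∃ C, ∀ i j t x, |g i j t x| ≤ C * (1 + ‖x‖ ^ 2)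
  /-- the triangle condition (2.7) on the switching costs -/
  g_triangle : ∀ i j k t x, i ≠ j → j ≠ k → i ≠ k → g i k t x < g i j t x + g j k t x
  /-- no cost for a fictitious switch (2.7) -/
  g_diag : ∀ i t x, g i i t x = 0
  /-- continuity of `F` on `[0,T] × P₂(S) × P(M)` (Assumption 2.1 (ii)) -/
  Fb_cont : ∀ (t : ℝ) (m : ProbabilityMeasure (S dd nN)) (l : ProbabilityMeasure M)
      (ts : ℕ → ℝ) (ms : ℕ → ProbabilityMeasure (S dd nN)) (ls : ℕ → ProbabilityMeasure M),
    Tendsto ts atTop (𝓝 t) → Tendsto (fun n => W2S (ms n) m) atTop (𝓝 0) →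
    (∀ q, Tendsto (fun n => pt (ls n) q) atTop (𝓝 (pt l q))) →
    Tendsto (fun n => Fb (ts n) (ms n) (ls n)) atTop (𝓝 (Fb t m l))
  /-- continuity of `H` (Assumption 2.1 (iii)) -/
  Hb_cont : ∀ (m : ProbabilityMeasure (S dd nN)) (l : ProbabilityMeasure M)
      (ms : ℕ → ProbabilityMeasure (S dd nN)) (ls : ℕ → ProbabilityMeasure M),
    Tendsto (fun n => W2S (ms n) m) atTop (𝓝 0) →
    (∀ q, Tendsto (fun n => pt (ls n) q) atTop (𝓝 (pt l q))) →
    Tendsto (fun n => Hb (ms n) (ls n)) atTop (𝓝 (Hb m l))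
  /-- continuity of `Gⁿ` (Assumption 2.1 (v)) -/
  G_cont : ∀ (n : ℕ) (t : ℝ) (m : ProbabilityMeasure (S dd nN)) (ts : ℕ → ℝ)
      (ms : ℕ → ProbabilityMeasure (S dd nN)),
    Tendsto ts atTop (𝓝 t) → Tendsto (fun k => W2S (ms k) m) atTop (𝓝 0) →
    Tendsto (fun k => G n (ts k) (ms k)) atTop (𝓝 (G n t m))

/-- A test function `φ ∈ C^{1,2}₂([0,T] × P₂(S))`, bundled with its time derivative,
its linear functional derivative `δ_m φ` and the space derivatives
`∂_x δ_m φ`, `∂²_{xx} δ_m φ` of the latter. -/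
structure TestFn (dd nN : ℕ) where
  toFun : ℝ → ProbabilityMeasure (S dd nN) → ℝ
  /-- `∂_t φ` -/
  dt : ℝ → ProbabilityMeasure (S dd nN) → ℝ
  /-- `δ_m φ` -/
  δ : ℝ → Measure (S dd nN) → S dd nN → ℝ
  /-- `∂_x δ_m φ` -/
  dxδ : ℝ → Measure (S dd nN) → S dd nN → (Fin dd → ℝ)
  /-- `∂²_{xx} δ_m φ` -/
  dxxδ : ℝ → Measure (S dd nN) → S dd nN → Matrix (Fin dd) (Fin dd) ℝ
  dt_prop : ∀ m t, HasDerivAt (fun s => toFun s m) (dt t m) t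
  /-- `δ` is the linear functional derivative of `φ` in `m` -/
  δ_prop : ∀ (t : ℝ) (m m' : ProbabilityMeasure (S dd nN)),
    toFun t m' - toFun t m = ∫ a in (0:ℝ)..1,
      ((∫ y, δ t (mix a (m : Measure (S dd nN)) (m' : Measure (S dd nN))) y
          ∂(m' : Measure (S dd nN))) -
       (∫ y, δ t (mix a (m : Measure (S dd nN)) (m' : Measure (S dd nN))) y
          ∂(m : Measure (S dd nN))))
  dxδ_prop : ∀ t μ x i w,
    HasDerivAt (fun s : ℝ => δ t μ (x + s • w, i)) (dxδ t μ (x, i) ⬝ᵥ w) 0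
  dxxδ_prop : ∀ t μ x i w w',
    HasDerivAt (fun s : ℝ => dxδ t μ (x + s • w', i) ⬝ᵥ w) ((dxxδ t μ (x, i)) *ᵥ w ⬝ᵥ w') 0
  /-- `∂²_{xx} δ_m φ` is bounded in the space variable -/
  dxxδ_bdd : ∀ t μ, ∃ C, ∀ y j k, |dxxδ t μ y j k| ≤ C
  /-- `δ_m φ` has quadratic growth -/
  δ_growth : ∀ t μ, ∃ C, ∀ y, |δ t μ y| ≤ C * (1 + ‖y.1‖ ^ 2)

variable {dd nN : ℕ} {M Ω : Type} [Fintype M] [DecidableEq M] [MeasurableSpace M]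
  [MeasurableSpace Ω]

/-- The operator `𝕃` of (2.13), applied to a (smooth) test function. -/
def Lop (St : Setting dd nN M Ω) (φ : TestFn dd nN) (t : ℝ)
    (m : ProbabilityMeasure (S dd nN)) (l : ProbabilityMeasure M) : ℝ :=
  φ.dt t m + ∑ q, pt l q *
    ∫ y, ((St.b t q y m) ⬝ᵥ (φ.dxδ t (m : Measure (S dd nN)) y) +
      (1 / 2) * Matrix.trace (St.σ t q y m * St.σ t q y m *
        (φ.dxxδ t (m : Measure (S dd nN)) y)ᵀ)) ∂(m : Measure (S dd nN))

/-- `m' ⪯ m` through the transition functions `p_{ij}` of (2.16) :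
`m'(dx, j) = Σ_i p_{ij}(x) m(dx, i)` with `Σ_j p_{ij} = 1`, `p_{ij} ≥ 0`. -/
def IsTransition {dd nN : ℕ} (m m' : ProbabilityMeasure (S dd nN))
    (p : Fin nN → Fin nN → (Fin dd → ℝ) → ℝ) : Prop :=
  (∀ i j x, 0 ≤ p i j x) ∧ (∀ i x, ∑ j, p i j x = 1) ∧
  ∀ (j : Fin nN) (A : Set (Fin dd → ℝ)), MeasurableSet A →
    ((m' : Measure (S dd nN)) (A ×ˢ ({j} : Set (Fin nN)))).toReal =
      ∑ i, ∫ x in A, p i j x ∂(mComp m i)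

/-- The total switching cost `Σ_i Σ_{j≠i} ∫ g_{ij}(t,x) p_{ij}(x) m(dx, i)`. -/
def transCost (St : Setting dd nN M Ω) (t : ℝ) (m : ProbabilityMeasure (S dd nN))
    (p : Fin nN → Fin nN → (Fin dd → ℝ) → ℝ) : ℝ :=
  ∑ i, ∑ j ∈ Finset.univ.erase i, ∫ x, St.g i j t x * p i j x ∂(mComp m i)

/-- The obstacle
`M[u](t,m;l) = sup_{m' ≺ m} { u(t,m';l) - Σ_i Σ_{j≠i} ∫ g_{ij}(t,x) p_{ij}(x) m(dx,i) }`. -/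
def Mobst (St : Setting dd nN M Ω)
    (u : ℝ → ProbabilityMeasure (S dd nN) → ProbabilityMeasure M → ℝ)
    (t : ℝ) (m : ProbabilityMeasure (S dd nN)) (l : ProbabilityMeasure M) : ℝ :=
  sSup {c | ∃ m' p, IsTransition m m' p ∧ (∃ i x, p i i x ≠ 1) ∧
    c = u t m' l - transCost St t m p}

/-- The viscosity neighbourhood
`N_δ(t,m;l) = {(s, m̃) : s ∈ [t, t+δ], P ∈ P(t,m;l), m̃ ∈ {P_{Y_{s-}}, P_{Y_s}}}`. -/
def Nbhd (St : Setting dd nN M Ω) (δ t : ℝ) (m : ProbabilityMeasure (S dd nN))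
    (l : ProbabilityMeasure M) : Set (ℝ × ProbabilityMeasure (S dd nN)) :=
  {sm | sm.1 ∈ Set.Icc t (t + δ) ∧
    ∃ p ∈ St.P t m l, sm.2 = St.YlawL p sm.1 ∨ sm.2 = St.Ylaw p sm.1}

/-- The set of limits of `u(s, m̃; l)` along sequences `(s, m̃) → (t, m)` inside the
neighbourhood `N_{T-t}(t, m; l)`. -/
def limPts (St : Setting dd nN M Ω)
    (u : ℝ → ProbabilityMeasure (S dd nN) → ProbabilityMeasure M → ℝ)
    (t : ℝ) (m : ProbabilityMeasure (S dd nN)) (l : ProbabilityMeasure M) : Set ℝ :=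
  {c | ∃ sq : ℕ → ℝ × ProbabilityMeasure (S dd nN),
    (∀ n, sq n ∈ Nbhd St (St.T - t) t m l) ∧
    Tendsto (fun n => |(sq n).1 - t| + W2S (sq n).2 m) atTop (𝓝 0) ∧
    Tendsto (fun n => u (sq n).1 (sq n).2 l) atTop (𝓝 c)}

/-- The lower semicontinuous envelope `u_*` of `u` relative to `P(t, m; l)`. -/
def lscEnv (St : Setting dd nN M Ω)
    (u : ℝ → ProbabilityMeasure (S dd nN) → ProbabilityMeasure M → ℝ)
    (t : ℝ) (m : ProbabilityMeasure (S dd nN)) (l : ProbabilityMeasure M) : ℝ :=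
  sInf (limPts St u t m l)

/-- The upper semicontinuous envelope `u^*` of `u` relative to `P(t, m; l)`. -/
def uscEnv (St : Setting dd nN M Ω)
    (u : ℝ → ProbabilityMeasure (S dd nN) → ProbabilityMeasure M → ℝ)
    (t : ℝ) (m : ProbabilityMeasure (S dd nN)) (l : ProbabilityMeasure M) : ℝ :=
  sSup (limPts St u t m l)

/-- `u` is upper semicontinuous along the viscosity neighbourhoods. -/
def IsUSCAlong (St : Setting dd nN M Ω)
    (u : ℝ → ProbabilityMeasure (S dd nN) → ProbabilityMeasure M → ℝ) : Prop :=
  ∀ t m l, t ∈ Set.Icc 0 St.T → ∀ c ∈ limPts St u t m l, c ≤ u t m l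

/-- `u` is lower semicontinuous along the viscosity neighbourhoods. -/
def IsLSCAlong (St : Setting dd nN M Ω)
    (u : ℝ → ProbabilityMeasure (S dd nN) → ProbabilityMeasure M → ℝ) : Prop :=
  ∀ t m l, t ∈ Set.Icc 0 St.T → ∀ c ∈ limPts St u t m l, u t m l ≤ c

/-- `φ ∈ 𝒜̄ u(t, m; l)` : test functions touching the LSC envelope of `u` from above
on some neighbourhood `N_δ(t, m; l)`. -/
def inAbar (St : Setting dd nN M Ω)
    (u : ℝ → ProbabilityMeasure (S dd nN) → ProbabilityMeasure M → ℝ)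
    (t : ℝ) (m : ProbabilityMeasure (S dd nN)) (l : ProbabilityMeasure M)
    (φ : TestFn dd nN) : Prop :=
  ∃ δ > 0, ∀ sm ∈ Nbhd St δ t m l,
    φ.toFun sm.1 sm.2 - lscEnv St u sm.1 sm.2 l ≤ φ.toFun t m - lscEnv St u t m l

/-- `φ ∈ 𝒜̲ u(t, m; l)` : test functions touching the USC envelope of `u` from below
on some neighbourhood `N_δ(t, m; l)`. -/
def inAunder (St : Setting dd nN M Ω)
    (u : ℝ → ProbabilityMeasure (S dd nN) → ProbabilityMeasure M → ℝ)
    (t : ℝ) (m : ProbabilityMeasure (S dd nN)) (l : ProbabilityMeasure M)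
    (φ : TestFn dd nN) : Prop :=
  ∃ δ > 0, ∀ sm ∈ Nbhd St δ t m l,
    φ.toFun t m - uscEnv St u t m l ≤ φ.toFun sm.1 sm.2 - uscEnv St u sm.1 sm.2 l

/-- `u` is a viscosity supersolution of the obstacle equation (2.17)
`min{ -(𝕃u + F + ℚu), u - M[u] } = 0` (Definition 3.1 (i)). -/
def IsSupersol (St : Setting dd nN M Ω)
    (u : ℝ → ProbabilityMeasure (S dd nN) → ProbabilityMeasure M → ℝ) : Prop :=
  ∀ t m l, t ∈ Set.Ico 0 St.T → FiniteSecondMoment m →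
    Mobst St (lscEnv St u) t m l ≤ lscEnv St u t m l ∧
    ∀ φ, inAbar St u t m l φ →
      0 ≤ -(Lop St φ t m l + St.Fb t m l + St.Qop (lscEnv St u) t m l)

/-- `u` is a viscosity subsolution of the obstacle equation (2.17) (Definition 3.1 (ii)). -/
def IsSubsol (St : Setting dd nN M Ω)
    (u : ℝ → ProbabilityMeasure (S dd nN) → ProbabilityMeasure M → ℝ) : Prop :=
  ∀ t m l, t ∈ Set.Ico 0 St.T → FiniteSecondMoment m →
    ∀ φ, inAunder St u t m l φ →
      min (-(Lop St φ t m l + St.Fb t m l + St.Qop (uscEnv St u) t m l))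
        (uscEnv St u t m l - Mobst St (uscEnv St u) t m l) ≤ 0

/-- `DΦ` is the linear functional derivative of `Φ` on probability measures. -/
def IsLinDerivM {γ : Type*} [MeasurableSpace γ] (Φ : Measure γ → ℝ)
    (DΦ : Measure γ → γ → ℝ) : Prop :=
  ∀ μ ν : ProbabilityMeasure γ, Φ (ν : Measure γ) - Φ (μ : Measure γ) =
    ∫ a in (0:ℝ)..1,
      ((∫ y, DΦ (mix a (μ : Measure γ) (ν : Measure γ)) y ∂(ν : Measure γ)) -
       (∫ y, DΦ (mix a (μ : Measure γ) (ν : Measure γ)) y ∂(μ : Measure γ)))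

/-- `U ∈ C^∞(P₂(S))` : all linear functional derivatives of every order exist and are
smooth in the space variables. -/
def SmoothAllOrders {dd nN : ℕ} (U : ProbabilityMeasure (S dd nN) → ℝ) : Prop :=
  ∃ D : (k : ℕ) → Measure (S dd nN) → (Fin k → S dd nN) → ℝ,
    (∀ m : ProbabilityMeasure (S dd nN), D 0 (m : Measure (S dd nN)) (fun i => i.elim0) = U m) ∧
    (∀ (k : ℕ) (ys : Fin k → S dd nN),
      IsLinDerivM (fun μ => D k μ ys) (fun μ z => D (k + 1) μ (Fin.snoc ys z))) ∧
    (∀ (k : ℕ) (μ : Measure (S dd nN)) (modes : Fin k → Fin nN),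
      ContDiff ℝ (⊤ : ℕ∞) (fun xs : Fin k → (Fin dd → ℝ) => D k μ (fun j => (xs j, modes j))))

lemma integral_mix {γ : Type*} [MeasurableSpace γ] {f : γ → ℝ} {a : ℝ} (ha : a ∈ Set.Icc (0:ℝ) 1)
    {μ ν : Measure γ} (hμ : Integrable f μ) (hν : Integrable f ν) :
    ∫ y, f y ∂(mix a μ ν) = (1 - a) * ∫ y, f y ∂μ + a * ∫ y, f y ∂ν := by
  rw [mix, integral_add_measure (hμ.smul_measure ENNReal.ofReal_ne_top)
    (hν.smul_measure ENNReal.ofReal_ne_top), integral_smul_measure, integral_smul_measure,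
    ENNReal.toReal_ofReal (by linarith [ha.2]), ENNReal.toReal_ofReal ha.1, smul_eq_mul,
    smul_eq_mul]

/-- A smooth function of finitely many integrals of smooth functions belongs to
`C^∞(P₂(S))`. -/
lemma smoothAllOrders_cylinder {dd nN : ℕ} {J : Type*} [Fintype J] {g : (J → ℝ) → ℝ}
    (hg : ContDiff ℝ (⊤ : ℕ∞) g) {φ : J → S dd nN → ℝ}
    (hint : ∀ (j : J) (m : ProbabilityMeasure (S dd nN)), Integrable (φ j) (m : Measure (S dd nN)))
    (hφ : ∀ j i, ContDiff ℝ (⊤ : ℕ∞) (fun x => φ j (x, i))) :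
    SmoothAllOrders (fun m : ProbabilityMeasure (S dd nN) =>
      g (fun j => ∫ y, φ j y ∂(m : Measure (S dd nN)))) := by
  refine ⟨fun k μ ys => iteratedFDeriv ℝ k g (fun j => ∫ y, φ j y ∂μ)
    (fun l => fun j => φ j (ys l.rev)), fun m => by simp, ?_, ?_⟩
  · intro k ys μ ν
    set P : J → ℝ := fun j => ∫ y, φ j y ∂(μ : Measure (S dd nN)) with hP
    set Q : J → ℝ := fun j => ∫ y, φ j y ∂(ν : Measure (S dd nN)) with hQ
    set v : Fin k → J → ℝ := fun l => fun j => φ j (ys l.rev) with hv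
    have hvec : ∀ (m : ProbabilityMeasure (S dd nN)),
        Integrable (fun y => fun j => φ j y) (m : Measure (S dd nN)) :=
      fun m => Integrable.of_eval fun j => hint j m
    have hdiff : Differentiable ℝ (iteratedFDeriv ℝ k g) :=
      hg.differentiable_iteratedFDeriv (by exact_mod_cast WithTop.coe_lt_top k)
    have hcontD : Continuous (fderiv ℝ (iteratedFDeriv ℝ k g)) :=
      ((hg.iteratedFDeriv_right (m := 1) (by exact_mod_cast le_top)).continuous_fderiv one_ne_zero)
    have key : ∀ a ∈ Set.Icc (0:ℝ) 1,
        (fun j => ∫ y, φ j y ∂(mix a (μ : Measure (S dd nN)) (ν : Measure (S dd nN))))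
          = P + a • (Q - P) := by
      intro a ha
      funext j
      rw [integral_mix ha (hint j μ) (hint j ν)]
      simp only [hP, hQ, Pi.add_apply, Pi.smul_apply, Pi.sub_apply, smul_eq_mul]
      ring
    have hsnoc : ∀ z : S dd nN, (fun l : Fin (k+1) => fun j =>
        φ j ((Fin.snoc ys z : Fin (k+1) → S dd nN) l.rev))
        = Fin.cons (fun j => φ j z) v := by
      intro z
      funext l
      refine Fin.cases ?_ (fun l => ?_) l
      · simp
      · simp [hv, Fin.rev_succ]
    have hI : ∀ (x : J → ℝ) (m : ProbabilityMeasure (S dd nN)),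
        ∫ y, iteratedFDeriv ℝ (k+1) g x (fun l => fun j =>
          φ j ((Fin.snoc ys y : Fin (k+1) → S dd nN) l.rev)) ∂(m : Measure (S dd nN))
        = fderiv ℝ (iteratedFDeriv ℝ k g) x (fun j => ∫ y, φ j y ∂(m : Measure (S dd nN))) v := by
      intro x m
      have h1 : ∀ y, iteratedFDeriv ℝ (k+1) g x (fun l => fun j =>
          φ j ((Fin.snoc ys y : Fin (k+1) → S dd nN) l.rev))
          = ((ContinuousMultilinearMap.apply ℝ (fun _ : Fin k => J → ℝ) ℝ v).comp
            (fderiv ℝ (iteratedFDeriv ℝ k g) x)) (fun j => φ j y) := by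
        intro y
        rw [hsnoc, iteratedFDeriv_succ_apply_left]
        simp
      simp_rw [h1]
      rw [ContinuousLinearMap.integral_comp_comm _ (hvec m)]
      have : (∫ y, (fun j => φ j y) ∂(m : Measure (S dd nN))) =
          fun j => ∫ y, φ j y ∂(m : Measure (S dd nN)) := by
        funext j
        exact (eval_integral (fun j => hint j m) j)
      rw [this]
      simp
    have hder : ∀ a : ℝ, HasDerivAt (fun a : ℝ => iteratedFDeriv ℝ k g (P + a • (Q - P)) v)
        (fderiv ℝ (iteratedFDeriv ℝ k g) (P + a • (Q - P)) (Q - P) v) a := by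
      intro a
      have h1 : HasDerivAt (fun a : ℝ => P + a • (Q - P)) (Q - P) a := by
        simpa using ((hasDerivAt_id a).smul_const (Q - P)).const_add P
      have h2 := (hdiff (P + a • (Q - P))).hasFDerivAt.comp_hasDerivAt a h1
      exact ((ContinuousMultilinearMap.apply ℝ (fun _ : Fin k => J → ℝ) ℝ v).hasFDerivAt
        (x := iteratedFDeriv ℝ k g (P + a • (Q - P)))).comp_hasDerivAt a h2
    have hcont : Continuous (fun a : ℝ =>
        fderiv ℝ (iteratedFDeriv ℝ k g) (P + a • (Q - P)) (Q - P) v) := by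
      have h1 : Continuous (fun a : ℝ => P + a • (Q - P)) := by fun_prop
      exact (ContinuousMultilinearMap.apply ℝ (fun _ : Fin k => J → ℝ) ℝ v).continuous.comp
        ((hcontD.comp h1).clm_apply continuous_const)
    have hftc := intervalIntegral.integral_eq_sub_of_hasDerivAt (a := 0) (b := 1)
      (fun a _ => hder a) (hcont.intervalIntegrable 0 1)
    have hend : iteratedFDeriv ℝ k g Q v - iteratedFDeriv ℝ k g P v =
        ∫ a in (0:ℝ)..1, fderiv ℝ (iteratedFDeriv ℝ k g) (P + a • (Q - P)) (Q - P) v := by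
      rw [hftc]; simp
    refine hend.trans (intervalIntegral.integral_congr fun a ha => ?_)
    rw [Set.uIcc_of_le zero_le_one] at ha
    simp only [key a ha]
    rw [hI, hI]
    simp [hP, hQ]
  · intro k μ modes
    refine (ContinuousMultilinearMap.contDiff _).comp ?_
    refine contDiff_pi.2 fun l => contDiff_pi.2 fun j => ?_
    exact (hφ j (modes l.rev)).comp (contDiff_apply ℝ _ l.rev)

/-- Truncation from below by `ε` followed by normalization. -/
def toSimplex {J : Type*} [Fintype J] [Nonempty J] {ε : ℝ} (hε : 0 < ε) (q : J → ℝ) :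
    stdSimplex ℝ J :=
  ⟨fun j => max (q j) ε / ∑ l, max (q l) ε, fun j => by positivity, by
    have : 0 < ∑ l, max (q l) ε := Finset.sum_pos (fun l _ => by positivity) Finset.univ_nonempty
    rw [← Finset.sum_div, div_self this.ne']⟩

lemma continuous_toSimplex {J : Type*} [Fintype J] [Nonempty J] {ε : ℝ} (hε : 0 < ε) :
    Continuous (toSimplex (J := J) hε) := by
  refine Continuous.subtype_mk (continuous_pi fun j => ?_) _
  have : ∀ q : J → ℝ, ∑ l, max (q l) ε ≠ 0 := fun q =>
    (Finset.sum_pos (fun l _ => by positivity) Finset.univ_nonempty).ne'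
  fun_prop (disch := exact this)

lemma toSimplex_eq_combo {J : Type*} [Fintype J] [Nonempty J] {ε : ℝ} (hε : 0 < ε) {z : J → ℝ}
    (hz : ∀ j, ε ≤ z j) :
    ∃ s ∈ Set.Icc (0:ℝ) 1, 1 - s ≤ ∑ j, z j ∧ ∃ r : stdSimplex ℝ J, ∀ p : stdSimplex ℝ J,
      (toSimplex hε (fun j => p.1 j + z j)).1 = fun j => s * p.1 j + (1 - s) * r.1 j := by
  have hpos : 0 < ∑ j, z j :=
    Finset.sum_pos (fun l _ => hε.trans_le (hz l)) Finset.univ_nonempty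
  set Z := ∑ j, z j with hZ
  refine ⟨1 / (1 + Z), ⟨by positivity, ?_⟩, ?_, ⟨fun j => z j / Z, fun j => ?_, ?_⟩, ?_⟩
  · rw [div_le_one (by positivity)]; linarith
  · rw [sub_le_iff_le_add, ← sub_le_iff_le_add', le_div_iff₀ (by positivity)]
    nlinarith
  · exact div_nonneg (hε.le.trans (hz j)) hpos.le
  · rw [← Finset.sum_div, ← hZ, div_self hpos.ne']
  · intro p
    have hmax : ∀ j, max (p.1 j + z j) ε = p.1 j + z j := fun j =>
      max_eq_left (by linarith [hz j, p.2.1 j])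
    funext j
    simp only [toSimplex, hmax, Finset.sum_add_distrib, p.2.2, ← hZ]
    field_simp
    ring

/-- Mollification of a continuous function on the standard simplex, in a way that preserves
translation-type estimates. -/
lemma exists_smooth_approx_simplex {J : Type*} [Fintype J] [Nonempty J] {G : stdSimplex ℝ J → ℝ}
    (hG : Continuous G) {η : ℝ} (hη : 0 < η) :
    ∃ g : (J → ℝ) → ℝ, ContDiff ℝ (⊤ : ℕ∞) g ∧ (∀ p : stdSimplex ℝ J, |g p.1 - G p| ≤ η) ∧
      ∀ (p p' : stdSimplex ℝ J) (B : ℝ),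
        (∀ s ∈ Set.Icc (0:ℝ) 1, ∀ r q q' : stdSimplex ℝ J,
          q.1 = (fun j => s * p.1 j + (1 - s) * r.1 j) →
          q'.1 = (fun j => s * p'.1 j + (1 - s) * r.1 j) → |G q - G q'| ≤ B) →
        |g p.1 - g p'.1| ≤ B := by
  obtain ⟨δ, hδ, hU⟩ := Metric.uniformContinuous_iff.1
    (CompactSpace.uniformContinuous_of_continuous hG) η hη
  set c : ℝ := (Fintype.card J : ℝ) with hc
  have hcpos : 0 < c := by rw [hc]; exact_mod_cast Fintype.card_pos
  set ε : ℝ := δ / (3 * c + 1) / 2 with hεdef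
  have hε : 0 < ε := by positivity
  have hεδ : 3 * c * ε < δ := by
    have : ε * (3 * c + 1) * 2 = δ := by rw [hεdef]; field_simp
    nlinarith
  let b : ContDiffBump (0 : J → ℝ) := ⟨ε / 2, ε, by positivity, by linarith⟩
  let H : (J → ℝ) → ℝ := fun q => G (toSimplex hε (fun j => q j + 2 * ε))
  have hH : Continuous H := hG.comp ((continuous_toSimplex hε).comp (by fun_prop))
  have hball : ∀ (p x : J → ℝ), x ∈ Metric.ball p b.rOut →
      ∀ j, ε ≤ x j - p j + 2 * ε ∧ x j - p j + 2 * ε ≤ 3 * ε := by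
    intro p x hx j
    have h1 : dist (x j) (p j) < ε := (dist_le_pi_dist x p j).trans_lt hx
    rw [Real.dist_eq, abs_lt] at h1
    constructor <;> linarith [h1.1, h1.2]
  have hsupp : Function.support (b.normed (volume : Measure (J → ℝ))) ⊆ Metric.ball 0 b.rOut :=
    (b.support_normed_eq).subset
  let g : (J → ℝ) → ℝ := convolution (b.normed volume) H (ContinuousLinearMap.lsmul ℝ ℝ) volume
  refine ⟨g, b.hasCompactSupport_normed.contDiff_convolution_left _ b.contDiff_normed
    hH.locallyIntegrable, fun p => ?_, fun p p' B hB => ?_⟩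
  · rw [← Real.dist_eq]
    refine dist_convolution_le hη.le hsupp b.nonneg_normed (b.integral_normed)
      hH.aestronglyMeasurable fun x hx => ?_
    obtain ⟨s, hs, hsZ, r, hr⟩ := toSimplex_eq_combo hε
      (z := fun j => x j - p.1 j + 2 * ε) (fun j => (hball _ _ hx j).1)
    refine (hU ?_).le
    have hrp := hr p
    have : (fun j => p.1 j + (x j - p.1 j + 2 * ε)) = fun j => x j + 2 * ε := by
      funext j; ring
    rw [this] at hrp
    rw [Subtype.dist_eq]
    refine (dist_pi_lt_iff hδ).2 fun j => ?_
    have hj := congrFun hrp j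
    rw [hj, Real.dist_eq]
    have e1 : s * p.1 j + (1 - s) * r.1 j - p.1 j = (1 - s) * (r.1 j - p.1 j) := by ring
    have hr1 := (mem_Icc_of_mem_stdSimplex r.2 j)
    have hp1 := (mem_Icc_of_mem_stdSimplex p.2 j)
    have h3 : |r.1 j - p.1 j| ≤ 1 := by
      rw [abs_le]; constructor <;> linarith [hr1.1, hr1.2, hp1.1, hp1.2]
    have h4 : ∑ j, (x j - p.1 j + 2 * ε) ≤ 3 * c * ε := by
      calc _ ≤ ∑ _j : J, 3 * ε := Finset.sum_le_sum fun j _ => (hball _ _ hx j).2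
        _ = 3 * c * ε := by simp [hc]; ring
    rw [e1, abs_mul, abs_of_nonneg (by linarith [hs.2])]
    calc (1 - s) * |r.1 j - p.1 j| ≤ (1 - s) * 1 := by
          gcongr; linarith [hs.2]
      _ < δ := by linarith
  · have hB0 : 0 ≤ B := (abs_nonneg _).trans
      (hB 1 ⟨zero_le_one, le_rfl⟩ p p p' (by simp) (by simp))
    let H' : (J → ℝ) → ℝ := fun x => H (x + (p'.1 - p.1))
    have hH' : Continuous H' := hH.comp (by fun_prop)
    have e1 : g p'.1 =
        convolution (b.normed volume) H' (ContinuousLinearMap.lsmul ℝ ℝ) volume p.1 := by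
      simp only [g, convolution, H']
      congr 1; funext t; congr 2; abel
    have e2 : g p.1 - g p'.1 = convolution (b.normed volume) (fun x => H x - H' x)
        (ContinuousLinearMap.lsmul ℝ ℝ) volume p.1 := by
      rw [e1]
      have hi : ∀ F : (J → ℝ) → ℝ, Continuous F → Integrable (fun t =>
          (ContinuousLinearMap.lsmul ℝ ℝ) (b.normed volume t) (F (p.1 - t))) := fun F hF =>
        b.hasCompactSupport_normed.convolutionExists_left _ b.continuous_normed
          hF.locallyIntegrable p.1
      simp only [g, convolution]
      rw [← integral_sub (hi H hH) (hi H' hH')]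
      congr 1; funext t; simp [mul_sub]
    have h := dist_convolution_le (z₀ := (0:ℝ)) (x₀ := p.1) (g := fun x => H x - H' x) hB0 hsupp
      b.nonneg_normed (b.integral_normed (μ := volume)) (hH.sub hH').aestronglyMeasurable ?_
    · rw [e2]; simpa [Real.dist_eq] using h
    · intro x hx
      obtain ⟨s, hs, -, r, hr⟩ := toSimplex_eq_combo hε
        (z := fun j => x j - p.1 j + 2 * ε) (fun j => (hball _ _ hx j).1)
      rw [Real.dist_eq, sub_zero]
      refine hB s hs r _ _ ?_ ?_
      · rw [← hr p]; congr 2; funext j; ring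
      · rw [← hr p']; congr 2; funext j; simp; ring

lemma Sdist_nonneg {dd nN : ℕ} (y y' : S dd nN) : 0 ≤ Sdist y y' := by
  unfold Sdist; split_ifs <;> positivity

lemma Sdist_self {dd nN : ℕ} (y : S dd nN) : Sdist y y = 0 := by simp [Sdist]

lemma Sdist_le {dd nN : ℕ} (y y' : S dd nN) : Sdist y y' ≤ ‖y.1‖ + ‖y'.1‖ + 1 := by
  unfold Sdist
  have := norm_sub_le y.1 y'.1
  split_ifs <;> linarith

lemma Sdist_triangle {dd nN : ℕ} (x y z : S dd nN) : Sdist x z ≤ Sdist x y + Sdist y z := by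
  unfold Sdist
  have := norm_sub_le_norm_sub_add_norm_sub x.1 y.1 z.1
  by_cases h1 : x.2 = y.2 <;> by_cases h2 : y.2 = z.2 <;> by_cases h3 : x.2 = z.2 <;>
    simp_all <;> linarith

lemma norm_sub_le_Sdist {dd nN : ℕ} (y y' : S dd nN) : ‖y.1 - y'.1‖ ≤ Sdist y y' := by
  unfold Sdist
  split_ifs <;> linarith

lemma measurable_Sdist {dd nN : ℕ} :
    Measurable (fun z : S dd nN × S dd nN => Sdist z.1 z.2) := by
  unfold Sdist
  refine Measurable.add (by fun_prop) (Measurable.ite ?_ measurable_const measurable_const)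
  exact measurableSet_eq_fun (by fun_prop) (by fun_prop)

lemma rpow_add_three_le {p a b c : ℝ} (hp : 0 ≤ p) (ha : 0 ≤ a) (hb : 0 ≤ b) (hc : 0 ≤ c) :
    (a + b + c) ^ p ≤ 3 ^ p * (a ^ p + b ^ p + c ^ p) := by
  set M := max a (max b c) with hM
  have h1 : a ≤ M := le_max_left _ _
  have h2 : b ≤ M := (le_max_left _ _).trans (le_max_right _ _)
  have h3 : c ≤ M := (le_max_right _ _).trans (le_max_right _ _)
  have hM0 : 0 ≤ M := ha.trans h1
  calc (a + b + c) ^ p ≤ (3 * M) ^ p := Real.rpow_le_rpow (by positivity) (by linarith) hp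
    _ = 3 ^ p * M ^ p := Real.mul_rpow (by norm_num) hM0
    _ ≤ 3 ^ p * (a ^ p + b ^ p + c ^ p) := by
      gcongr
      have := Real.rpow_nonneg ha p
      have := Real.rpow_nonneg hb p
      have := Real.rpow_nonneg hc p
      rcases max_choice a (max b c) with h | h
      · rw [hM, h]; linarith
      · rcases max_choice b c with h' | h' <;> rw [hM, h, h'] <;> linarith

/-- Finiteness of the `p`-th moment. -/
def HasMoment {dd nN : ℕ} (p : ℝ) (m : ProbabilityMeasure (S dd nN)) : Prop :=
  Integrable (fun y : S dd nN => ‖y.1‖ ^ p) (m : Measure (S dd nN))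

lemma hasMoment_iff {dd nN : ℕ} {p : ℝ} (m : ProbabilityMeasure (S dd nN)) :
    HasMoment p m ↔ ∫⁻ y, ENNReal.ofReal (‖y.1‖ ^ p) ∂(m : Measure (S dd nN)) < ⊤ := by
  have hm : Measurable (fun y : S dd nN => ‖y.1‖ ^ p) := by fun_prop
  rw [HasMoment, Integrable, hasFiniteIntegral_iff_ofReal (ae_of_all _ fun y => by positivity)]
  exact ⟨fun h => h.2, fun h => ⟨hm.aestronglyMeasurable, h⟩⟩

lemma hasMoment_two_iff {dd nN : ℕ} (m : ProbabilityMeasure (S dd nN)) :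
    HasMoment 2 m ↔ FiniteSecondMoment m := by
  simp [hasMoment_iff, FiniteSecondMoment]

lemma hasMoment_one_iff {dd nN : ℕ} (m : ProbabilityMeasure (S dd nN)) :
    HasMoment 1 m ↔ FiniteFirstMoment m := by
  simp [hasMoment_iff, FiniteFirstMoment]

/-- `π` is a coupling of `μ` and `ν`. -/
def IsCoupling {γ : Type*} [MeasurableSpace γ] (π : Measure (γ × γ))
    (μ ν : ProbabilityMeasure γ) : Prop :=
  IsProbabilityMeasure π ∧ π.map Prod.fst = (μ : Measure γ) ∧ π.map Prod.snd = (ν : Measure γ)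

/-- The transport cost of order `p` of a coupling. -/
def cost {dd nN : ℕ} (p : ℝ) (π : Measure (S dd nN × S dd nN)) : ℝ :=
  ∫ z, Sdist z.1 z.2 ^ p ∂π

lemma cost_nonneg {dd nN : ℕ} (p : ℝ) (π : Measure (S dd nN × S dd nN)) : 0 ≤ cost p π :=
  integral_nonneg fun _ => Real.rpow_nonneg (Sdist_nonneg _ _) _

lemma Wp_nonneg {dd nN : ℕ} (p : ℝ) (μ ν : ProbabilityMeasure (S dd nN)) :
    0 ≤ Wp Sdist p μ ν := by
  refine Real.sInf_nonneg ?_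
  rintro r ⟨π, -, -, -, rfl⟩
  exact Real.rpow_nonneg (cost_nonneg p π) _

lemma Wp_le_of_coupling {dd nN : ℕ} {p : ℝ} {μ ν : ProbabilityMeasure (S dd nN)}
    {π : Measure (S dd nN × S dd nN)} (h : IsCoupling π μ ν) :
    Wp Sdist p μ ν ≤ cost p π ^ (1 / p) := by
  refine csInf_le ⟨0, ?_⟩ ⟨π, h.1, h.2.1, h.2.2, rfl⟩
  rintro r ⟨π, -, -, -, rfl⟩
  exact Real.rpow_nonneg (cost_nonneg p π) _

lemma isCoupling_prod {γ : Type*} [MeasurableSpace γ] (μ ν : ProbabilityMeasure γ) :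
    IsCoupling ((μ : Measure γ).prod (ν : Measure γ)) μ ν :=
  ⟨inferInstance, by simp, by simp⟩

lemma exists_coupling_lt {dd nN : ℕ} {p δ : ℝ} (hδ : 0 < δ)
    (μ ν : ProbabilityMeasure (S dd nN)) :
    ∃ π, IsCoupling π μ ν ∧ cost p π ^ (1 / p) < Wp Sdist p μ ν + δ := by
  have hc := isCoupling_prod μ ν
  obtain ⟨r, ⟨π, h1, h2, h3, rfl⟩, hlt⟩ := exists_lt_of_csInf_lt
    (s := {r | ∃ π : Measure (S dd nN × S dd nN), IsProbabilityMeasure π ∧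
      π.map Prod.fst = (μ : Measure (S dd nN)) ∧ π.map Prod.snd = (ν : Measure (S dd nN)) ∧
      r = (∫ z, Sdist z.1 z.2 ^ p ∂π) ^ (1 / p)}) (b := Wp Sdist p μ ν + δ)
    ⟨_, _, hc.1, hc.2.1, hc.2.2, rfl⟩ (by change Wp Sdist p μ ν < _; linarith)
  exact ⟨π, ⟨h1, h2, h3⟩, hlt⟩

lemma IsCoupling.integrable_fst {γ : Type*} [MeasurableSpace γ] {π : Measure (γ × γ)}
    {μ ν : ProbabilityMeasure γ} (h : IsCoupling π μ ν) {f : γ → ℝ}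
    (hf : Integrable f (μ : Measure γ)) : Integrable (fun z => f z.1) π := by
  rw [← h.2.1] at hf
  exact hf.comp_measurable measurable_fst

lemma IsCoupling.integrable_snd {γ : Type*} [MeasurableSpace γ] {π : Measure (γ × γ)}
    {μ ν : ProbabilityMeasure γ} (h : IsCoupling π μ ν) {f : γ → ℝ}
    (hf : Integrable f (ν : Measure γ)) : Integrable (fun z => f z.2) π := by
  rw [← h.2.2] at hf
  exact hf.comp_measurable measurable_snd

lemma IsCoupling.integral_fst {γ : Type*} [MeasurableSpace γ] {π : Measure (γ × γ)}
    {μ ν : ProbabilityMeasure γ} (h : IsCoupling π μ ν) {f : γ → ℝ}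
    (hf : Integrable f (μ : Measure γ)) : ∫ z, f z.1 ∂π = ∫ y, f y ∂(μ : Measure γ) := by
  have hf' := hf.aestronglyMeasurable
  rw [← h.2.1] at hf' ⊢
  exact (integral_map measurable_fst.aemeasurable hf').symm

lemma IsCoupling.integral_snd {γ : Type*} [MeasurableSpace γ] {π : Measure (γ × γ)}
    {μ ν : ProbabilityMeasure γ} (h : IsCoupling π μ ν) {f : γ → ℝ}
    (hf : Integrable f (ν : Measure γ)) : ∫ z, f z.2 ∂π = ∫ y, f y ∂(ν : Measure γ) := by
  have hf' := hf.aestronglyMeasurable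
  rw [← h.2.2] at hf' ⊢
  exact (integral_map measurable_snd.aemeasurable hf').symm

lemma IsCoupling.integrable_cost {dd nN : ℕ} {p : ℝ} (hp : 0 ≤ p)
    {μ ν : ProbabilityMeasure (S dd nN)} {π : Measure (S dd nN × S dd nN)}
    (h : IsCoupling π μ ν) (hμ : HasMoment p μ) (hν : HasMoment p ν) :
    Integrable (fun z => Sdist z.1 z.2 ^ p) π := by
  have := h.1
  have hi : Integrable (fun z : S dd nN × S dd nN =>
      3 ^ p * (‖z.1.1‖ ^ p + ‖z.2.1‖ ^ p + 1 ^ p)) π :=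
    (((h.integrable_fst hμ).add (h.integrable_snd hν)).add (integrable_const _)).const_mul _
  refine hi.mono' (measurable_Sdist.pow_const p).aestronglyMeasurable (ae_of_all _ fun z => ?_)
  rw [Real.norm_of_nonneg (Real.rpow_nonneg (Sdist_nonneg _ _) _)]
  exact (Real.rpow_le_rpow (Sdist_nonneg _ _) (Sdist_le _ _) hp).trans
    (rpow_add_three_le hp (norm_nonneg _) (norm_nonneg _) zero_le_one)

lemma exists_couplings_of_tendsto {dd nN : ℕ} {p : ℝ} (hp : 0 < p)
    {ms : ℕ → ProbabilityMeasure (S dd nN)} {m : ProbabilityMeasure (S dd nN)}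
    (h : Tendsto (fun k => Wp Sdist p (ms k) m) atTop (𝓝 0)) :
    ∃ π : ℕ → Measure (S dd nN × S dd nN), (∀ k, IsCoupling (π k) (ms k) m) ∧
      Tendsto (fun k => cost p (π k)) atTop (𝓝 0) := by
  choose π hπ hlt using fun k : ℕ =>
    exists_coupling_lt (p := p) (Nat.one_div_pos_of_nat (α := ℝ) (n := k)) (ms k) m
  refine ⟨π, hπ, ?_⟩
  have h1 : Tendsto (fun k => cost p (π k) ^ (1 / p)) atTop (𝓝 0) :=
    squeeze_zero (fun k => Real.rpow_nonneg (cost_nonneg _ _) _) (fun k => (hlt k).le)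
      (by simpa using h.add tendsto_one_div_add_atTop_nhds_zero_nat)
  have h2 := h1.rpow_const (p := p) (Or.inr hp.le)
  rw [Real.zero_rpow hp.ne'] at h2
  refine h2.congr fun k => ?_
  rw [← Real.rpow_mul (cost_nonneg _ _), one_div_mul_cancel hp.ne', Real.rpow_one]

lemma tendsto_Wp_of_couplings {dd nN : ℕ} {p : ℝ} (hp : 0 < p)
    {ms ms' : ℕ → ProbabilityMeasure (S dd nN)}
    {π : ℕ → Measure (S dd nN × S dd nN)} (hπ : ∀ k, IsCoupling (π k) (ms k) (ms' k))
    (h : Tendsto (fun k => cost p (π k)) atTop (𝓝 0)) :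
    Tendsto (fun k => Wp Sdist p (ms k) (ms' k)) atTop (𝓝 0) := by
  have h2 := h.rpow_const (p := 1 / p) (Or.inr (by positivity))
  rw [Real.zero_rpow (by positivity)] at h2
  exact squeeze_zero (fun k => Wp_nonneg _ _ _) (fun k => Wp_le_of_coupling (hπ k)) h2

lemma Wp_one_le_of_coupling {dd nN : ℕ} {μ ν : ProbabilityMeasure (S dd nN)}
    {π : Measure (S dd nN × S dd nN)} (h : IsCoupling π μ ν) :
    Wp Sdist 1 μ ν ≤ cost 1 π := by
  simpa using Wp_le_of_coupling (p := 1) h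

lemma le_mul_Wp_one {dd nN : ℕ} {μ ν : ProbabilityMeasure (S dd nN)} {B C : ℝ} (hC : 0 ≤ C)
    (h : ∀ π, IsCoupling π μ ν → B ≤ C * cost 1 π) : B ≤ C * Wp Sdist 1 μ ν := by
  refine le_of_forall_pos_le_add fun δ hδ => ?_
  obtain ⟨π, hπ, hlt⟩ := exists_coupling_lt (p := 1) (δ := δ / (C + 1)) (by positivity) μ ν
  simp only [ne_eq, one_ne_zero, not_false_eq_true, div_self, Real.rpow_one] at hlt
  have h1 : C * (δ / (C + 1)) ≤ δ := by
    rw [mul_div_assoc', div_le_iff₀ (by positivity)]; nlinarith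
  calc B ≤ C * cost 1 π := h π hπ
    _ ≤ C * (Wp Sdist 1 μ ν + δ / (C + 1)) := by gcongr
    _ ≤ _ := by linarith

/-- The finitely supported measure with atoms `x j` of weights `w j`. -/
def discM {J γ : Type*} [Fintype J] [MeasurableSpace γ] (x : J → γ) (w : J → ℝ) : Measure γ :=
  ∑ j, ENNReal.ofReal (w j) • Measure.dirac (x j)

lemma isProbabilityMeasure_discM {J γ : Type*} [Fintype J] [MeasurableSpace γ] (x : J → γ)
    {w : J → ℝ} (hw : w ∈ stdSimplex ℝ J) : IsProbabilityMeasure (discM x w) := by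
  constructor
  simp only [discM, Measure.coe_finsetSum, Finset.sum_apply, Measure.smul_apply, measure_univ,
    smul_eq_mul, mul_one]
  rw [← ENNReal.ofReal_sum_of_nonneg fun j _ => hw.1 j, hw.2, ENNReal.ofReal_one]

lemma map_discM {J γ γ' : Type*} [Fintype J] [MeasurableSpace γ] [MeasurableSpace γ']
    {f : γ → γ'} (hf : Measurable f) (x : J → γ) (w : J → ℝ) :
    (discM x w).map f = discM (fun j => f (x j)) w := by
  rw [discM, Measure.map_finset_sum hf.aemeasurable]
  simp [discM, Measure.map_smul, Measure.map_dirac' hf]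

lemma integrable_discM {J γ : Type*} [Fintype J] [MeasurableSpace γ] [MeasurableSingletonClass γ]
    (f : γ → ℝ) (x : J → γ) (w : J → ℝ) : Integrable f (discM x w) := by
  refine integrable_finsetSum_measure.2 fun j _ => ?_
  exact (integrable_dirac (by simp)).smul_measure ENNReal.ofReal_ne_top

lemma integral_discM {J γ : Type*} [Fintype J] [MeasurableSpace γ] [MeasurableSingletonClass γ]
    (f : γ → ℝ) (x : J → γ) {w : J → ℝ} (hw : ∀ j, 0 ≤ w j) :
    ∫ y, f y ∂(discM x w) = ∑ j, w j * f (x j) := by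
  rw [discM, integral_finsetSum_measure
    fun j _ => (integrable_dirac (by simp)).smul_measure ENNReal.ofReal_ne_top]
  simp [integral_smul_measure, ENNReal.toReal_ofReal (hw _)]

/-- `discM` as a probability measure. -/
def disc {J γ : Type*} [Fintype J] [MeasurableSpace γ] (x : J → γ) (q : stdSimplex ℝ J) :
    ProbabilityMeasure γ :=
  ⟨discM x q.1, isProbabilityMeasure_discM x q.2⟩

lemma hasMoment_disc {J : Type*} [Fintype J] {dd nN : ℕ} (p : ℝ) (x : J → S dd nN)
    (q : stdSimplex ℝ J) : HasMoment p (disc x q) :=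
  integrable_discM _ _ _

lemma discM_fst {J γ : Type*} [Fintype J] [MeasurableSpace γ] (x : J → γ) {w : J × J → ℝ}
    (hw : ∀ z, 0 ≤ w z) :
    discM (fun z : J × J => x z.1) w = discM x (fun j => ∑ l, w (j, l)) := by
  simp only [discM, Fintype.sum_prod_type]
  exact Finset.sum_congr rfl fun j _ => by
    rw [← Finset.sum_smul, ENNReal.ofReal_sum_of_nonneg fun l _ => hw _]

lemma discM_snd {J γ : Type*} [Fintype J] [MeasurableSpace γ] (x : J → γ) {w : J × J → ℝ}
    (hw : ∀ z, 0 ≤ w z) :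
    discM (fun z : J × J => x z.2) w = discM x (fun l => ∑ j, w (j, l)) := by
  simp only [discM, Fintype.sum_prod_type_right]
  exact Finset.sum_congr rfl fun j _ => by
    rw [← Finset.sum_smul, ENNReal.ofReal_sum_of_nonneg fun l _ => hw _]

/-- Keeping the common mass in place and transporting the rest by a product coupling. -/
lemma exists_coupling_disc {J : Type*} [Fintype J] {dd nN : ℕ} {p : ℝ} (hp : 0 < p)
    (x : J → S dd nN) (q q' : stdSimplex ℝ J) :
    ∃ π, IsCoupling π (disc x q) (disc x q') ∧
      cost p π ≤ ∑ j, ∑ l, |q.1 l - q'.1 l| * Sdist (x j) (x l) ^ p := by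
  classical
  set a : J → ℝ := fun j => q.1 j - min (q.1 j) (q'.1 j) with ha
  set b : J → ℝ := fun j => q'.1 j - min (q.1 j) (q'.1 j) with hb
  have ha0 : ∀ j, 0 ≤ a j := fun j => sub_nonneg.2 (min_le_left _ _)
  have hb0 : ∀ j, 0 ≤ b j := fun j => sub_nonneg.2 (min_le_right _ _)
  set r := ∑ j, a j with hr
  have hrb : ∑ j, b j = r := by
    rw [hr, ha, hb, Finset.sum_sub_distrib, Finset.sum_sub_distrib, q.2.2, q'.2.2]
  have hr0 : 0 ≤ r := Finset.sum_nonneg fun j _ => ha0 j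
  set w : J × J → ℝ := fun z =>
    (if z.1 = z.2 then min (q.1 z.1) (q'.1 z.1) else 0) + a z.1 * b z.2 / r with hw
  have hw0 : ∀ z, 0 ≤ w z := fun z => by
    refine add_nonneg ?_ (div_nonneg (mul_nonneg (ha0 _) (hb0 _)) hr0)
    split_ifs
    · exact le_min (q.2.1 _) (q'.2.1 _)
    · exact le_rfl
  have hfst : (fun j => ∑ l, w (j, l)) = q.1 := by
    funext j
    simp only [hw, Finset.sum_add_distrib, Finset.sum_ite_eq, Finset.mem_univ, if_true]
    rw [← Finset.sum_div, ← Finset.mul_sum, hrb]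
    rcases eq_or_ne r 0 with h0 | h0
    · have := (Finset.sum_eq_zero_iff_of_nonneg fun j _ => ha0 j).1 (hr.symm.trans h0) j
        (Finset.mem_univ j)
      simp only [h0, div_zero, add_zero]
      simp only [ha] at this
      linarith
    · rw [mul_div_cancel_right₀ _ h0]; simp [ha]
  have hsnd : (fun l => ∑ j, w (j, l)) = q'.1 := by
    funext l
    simp only [hw, Finset.sum_add_distrib, Finset.sum_ite_eq', Finset.mem_univ, if_true]
    rw [← Finset.sum_div, ← Finset.sum_mul, ← hr]
    rcases eq_or_ne r 0 with h0 | h0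
    · have := (Finset.sum_eq_zero_iff_of_nonneg fun j _ => hb0 j).1 (hrb.trans h0) l
        (Finset.mem_univ l)
      simp only [h0, div_zero, add_zero]
      simp only [hb] at this
      linarith
    · rw [mul_div_cancel_left₀ _ h0]; simp [hb]
  have hwS : w ∈ stdSimplex ℝ (J × J) := ⟨hw0, by
    rw [Fintype.sum_prod_type]
    exact (Finset.sum_congr rfl fun j _ => congrFun hfst j).trans q.2.2⟩
  refine ⟨discM (fun z : J × J => (x z.1, x z.2)) w,
    ⟨isProbabilityMeasure_discM _ hwS, ?_, ?_⟩, ?_⟩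
  · rw [map_discM measurable_fst, discM_fst x hw0, hfst]; rfl
  · rw [map_discM measurable_snd, discM_snd x hw0, hsnd]; rfl
  · rw [cost, integral_discM _ _ hw0, Fintype.sum_prod_type]
    refine Finset.sum_le_sum fun j _ => Finset.sum_le_sum fun l _ => ?_
    have hD : 0 ≤ Sdist (x j) (x l) ^ p := Real.rpow_nonneg (Sdist_nonneg _ _) _
    by_cases hjl : j = l
    · subst hjl
      simp [Sdist_self, Real.zero_rpow hp.ne']
    · refine mul_le_mul_of_nonneg_right ?_ hD
      simp only [hw, hjl, if_false, zero_add]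
      calc a j * b l / r ≤ b l := by
            rw [mul_div_right_comm]
            refine mul_le_of_le_one_left (hb0 l) (div_le_one_of_le₀ ?_ hr0)
            exact Finset.single_le_sum (fun j _ => ha0 j) (Finset.mem_univ j)
        _ ≤ |q.1 l - q'.1 l| := by
            simp only [hb]
            rcases le_total (q.1 l) (q'.1 l) with h | h
            · rw [min_eq_left h, abs_sub_comm]; exact le_abs_self _
            · rw [min_eq_right h]; simp

lemma tendsto_Wp_disc {J : Type*} [Fintype J] {dd nN : ℕ} {p : ℝ} (hp : 0 < p)
    (x : J → S dd nN) {qs : ℕ → stdSimplex ℝ J} {q : stdSimplex ℝ J}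
    (h : Tendsto qs atTop (𝓝 q)) :
    Tendsto (fun k => Wp Sdist p (disc x (qs k)) (disc x q)) atTop (𝓝 0) := by
  choose π hπ hc using fun k => exists_coupling_disc hp x (qs k) q
  refine tendsto_Wp_of_couplings hp hπ (squeeze_zero (fun k => cost_nonneg _ _) hc ?_)
  have h1 : ∀ l, Tendsto (fun k => (qs k).1 l) atTop (𝓝 (q.1 l)) := fun l =>
    ((continuous_apply l).comp continuous_subtype_val).continuousAt.tendsto.comp h
  have h2 : Tendsto (fun k => ∑ j, ∑ l, |(qs k).1 l - q.1 l| * Sdist (x j) (x l) ^ p) atTop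
      (𝓝 (∑ j, ∑ l, |q.1 l - q.1 l| * Sdist (x j) (x l) ^ p)) :=
    tendsto_finsetSum _ fun j _ => tendsto_finsetSum _ fun l _ =>
      (((h1 l).sub_const _).abs).mul_const _
  simpa using h2

lemma discM_combo {J γ : Type*} [Fintype J] [MeasurableSpace γ] (x : J → γ) {s : ℝ}
    (hs : s ∈ Set.Icc (0:ℝ) 1) (p r : stdSimplex ℝ J) :
    discM x (fun j => s * p.1 j + (1 - s) * r.1 j)
      = mix (1 - s) (discM x p.1) (discM x r.1) := by
  have h1 : 0 ≤ 1 - s := by linarith [hs.2]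
  simp only [discM, mix, sub_sub_cancel, Finset.smul_sum, ← Finset.sum_add_distrib, smul_smul,
    ← add_smul, ← ENNReal.ofReal_mul hs.1, ← ENNReal.ofReal_mul h1]
  exact Finset.sum_congr rfl fun j _ => by
    rw [ENNReal.ofReal_add (mul_nonneg hs.1 (p.2.1 j)) (mul_nonneg h1 (r.2.1 j))]

/-- Mixing both marginals with a common measure contracts transport costs. -/
lemma exists_coupling_combo {J : Type*} [Fintype J] {dd nN : ℕ} (x : J → S dd nN) {s : ℝ}
    (hs : s ∈ Set.Icc (0:ℝ) 1) {p p' r q q' : stdSimplex ℝ J}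
    (hq : q.1 = fun j => s * p.1 j + (1 - s) * r.1 j)
    (hq' : q'.1 = fun j => s * p'.1 j + (1 - s) * r.1 j)
    {π : Measure (S dd nN × S dd nN)} (hπ : IsCoupling π (disc x p) (disc x p')) :
    ∃ π', IsCoupling π' (disc x q) (disc x q') ∧ cost 1 π' ≤ cost 1 π := by
  have h1 : 1 - s ∈ Set.Icc (0:ℝ) 1 := ⟨by linarith [hs.2], by linarith [hs.1]⟩
  have hprob := hπ.1
  set ρ : Measure (S dd nN × S dd nN) := discM (fun j => (x j, x j)) r.1 with hρ
  have hρp : IsProbabilityMeasure ρ := isProbabilityMeasure_discM _ r.2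
  have hmap : ∀ f : S dd nN × S dd nN → S dd nN, Measurable f →
      (mix (1 - s) π ρ).map f = mix (1 - s) (π.map f) (ρ.map f) := fun f hf => by
    simp [mix, Measure.map_add _ _ hf, Measure.map_smul]
  refine ⟨mix (1 - s) π ρ, ⟨⟨?_⟩, ?_, ?_⟩, ?_⟩
  · simp only [mix, sub_sub_cancel, Measure.add_apply, Measure.smul_apply, measure_univ,
      smul_eq_mul, mul_one]
    rw [← ENNReal.ofReal_add hs.1 h1.1]; simp
  · rw [hmap _ measurable_fst, hπ.2.1, hρ, map_discM measurable_fst]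
    change _ = discM x q.1
    rw [hq, discM_combo x hs]; rfl
  · rw [hmap _ measurable_snd, hπ.2.2, hρ, map_discM measurable_snd]
    change _ = discM x q'.1
    rw [hq', discM_combo x hs]; rfl
  · rw [cost, integral_mix h1 (hπ.integrable_cost zero_le_one (hasMoment_disc _ _ _)
      (hasMoment_disc _ _ _)) (integrable_discM _ _ _), integral_discM _ _ r.2.1]
    simp only [Sdist_self, Real.rpow_one, mul_zero, Finset.sum_const_zero, add_zero,
      sub_sub_cancel]
    have := cost_nonneg 1 π
    simp only [cost, Real.rpow_one] at this ⊢
    exact mul_le_of_le_one_left this hs.2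

lemma sum_clamp (t : ℝ) (K : ℕ) :
    ∑ k ∈ Finset.range K, max 0 (min (t - k) 1) = max 0 (min t K) := by
  induction K with
  | zero => simp
  | succ K ih =>
    rw [Finset.sum_range_succ, ih]
    push_cast
    have hK : (0:ℝ) ≤ K := Nat.cast_nonneg K
    rcases le_total t K with h | h
    · rw [min_eq_left h, min_eq_left (by linarith : t ≤ K + 1),
        max_eq_left (a := 0) (b := min (t - K) 1) ((min_le_left _ _).trans (by linarith)), add_zero]
    · rw [min_eq_right h, max_eq_right hK]
      rcases le_total (t - K) 1 with h' | h'
      · rw [min_eq_left h', max_eq_right (by linarith), min_eq_left (by linarith : t ≤ K + 1),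
          max_eq_right (by linarith)]
        ring
      · rw [min_eq_right h', max_eq_right zero_le_one, min_eq_right (by linarith),
          max_eq_right (by linarith)]

/-- A random threshold decision: always `false` for `u ≤ 0`, always `true` for `u ≥ 1`. -/
def passes (u : ℝ) (v : unitInterval) : Bool :=
  decide (0 < u ∧ (v : ℝ) ≤ Real.smoothTransition u)

/-- The decision `passes` as a number. -/
def indPass (u : ℝ) (v : unitInterval) : ℝ := if passes u v then 1 else 0

lemma indPass_nonneg (u : ℝ) (v : unitInterval) : 0 ≤ indPass u v := by
  unfold indPass; split_ifs <;> norm_num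

lemma indPass_le_one (u : ℝ) (v : unitInterval) : indPass u v ≤ 1 := by
  unfold indPass; split_ifs <;> norm_num

lemma indPass_of_nonpos {u : ℝ} (hu : u ≤ 0) (v : unitInterval) : indPass u v = 0 := by
  simp [indPass, passes, not_lt.2 hu]

lemma indPass_of_one_le {u : ℝ} (hu : 1 ≤ u) (v : unitInterval) : indPass u v = 1 := by
  have : 0 < u := by linarith
  simp [indPass, passes, this, Real.smoothTransition.one_of_one_le hu, v.2.2]

lemma indPass_mono {u u' : ℝ} (h : u ≤ u') (v : unitInterval) : indPass u v ≤ indPass u' v := by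
  unfold indPass passes
  by_cases h1 : 0 < u ∧ (v : ℝ) ≤ Real.smoothTransition u
  · have h2 : 0 < u' ∧ (v : ℝ) ≤ Real.smoothTransition u' :=
      ⟨h1.1.trans_le h, h1.2.trans (Real.smoothTransition.monotone h)⟩
    simp [h1, h2]
  · simp only [h1, decide_false]
    split_ifs <;> simp_all

lemma measurable_passes : Measurable (fun z : ℝ × unitInterval => passes z.1 z.2) := by
  refine measurable_to_bool ?_
  have : (fun z : ℝ × unitInterval => passes z.1 z.2) ⁻¹' {true}
      = {z | 0 < z.1} ∩ {z | (z.2 : ℝ) ≤ Real.smoothTransition z.1} := by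
    ext z; simp [passes]
  rw [this]
  have hs : Measurable Real.smoothTransition := Real.smoothTransition.continuous.measurable
  exact (measurableSet_lt measurable_const measurable_fst).inter
    (measurableSet_le (by fun_prop) (hs.comp measurable_fst))

lemma measurable_indPass : Measurable (fun z : ℝ × unitInterval => indPass z.1 z.2) := by
  unfold indPass
  exact Measurable.ite (measurable_passes (measurableSet_singleton true)) measurable_const
    measurable_const

lemma volume_passes (u : ℝ) :
    volume {v | passes u v = true} = ENNReal.ofReal (Real.smoothTransition u) := by
  rcases le_or_gt u 0 with hu | hu
  · simp [passes, not_lt.2 hu, Real.smoothTransition.zero_of_nonpos hu]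
  · have : {v | passes u v = true} = Set.Iic (⟨Real.smoothTransition u,
        Real.smoothTransition.nonneg u, Real.smoothTransition.le_one u⟩ : unitInterval) := by
      ext v; simp [passes, hu, ← Subtype.coe_le_coe]
    rw [this, unitInterval.volume_Iic]

lemma volume_not_passes (u : ℝ) :
    volume {v | passes u v = false} = ENNReal.ofReal (1 - Real.smoothTransition u) := by
  have h : {v | passes u v = false} = {v | passes u v = true}ᶜ := by ext; simp
  have hm : MeasurableSet {v | passes u v = true} :=
    (measurable_passes.comp (by fun_prop : Measurable fun v : unitInterval => (u, v)))
      (measurableSet_singleton true)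
  rw [h, prob_compl_eq_one_sub hm, volume_passes, ENNReal.ofReal_sub _
    (Real.smoothTransition.nonneg u), ENNReal.ofReal_one]

lemma integrable_indPass (u : ℝ) : Integrable (indPass u) := by
  refine (integrable_const (1:ℝ)).mono'
    (measurable_indPass.comp (by fun_prop : Measurable fun v : unitInterval => (u, v))
      ).aestronglyMeasurable (ae_of_all _ fun v => ?_)
  rw [Real.norm_of_nonneg (indPass_nonneg _ _)]
  exact indPass_le_one _ _

lemma integral_indPass (u : ℝ) : ∫ v, indPass u v = Real.smoothTransition u := by
  have h : indPass u = Set.indicator {v | passes u v = true} (fun _ => (1:ℝ)) := by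
    ext v; simp [indPass, Set.indicator]
  have hm : MeasurableSet {v | passes u v = true} :=
    (measurable_passes.comp (by fun_prop : Measurable fun v : unitInterval => (u, v)))
      (measurableSet_singleton true)
  rw [h, integral_indicator_const _ hm, Measure.real, volume_passes]
  simp [ENNReal.toReal_ofReal (Real.smoothTransition.nonneg u)]

lemma integral_abs_indPass_sub (u u' : ℝ) :
    ∫ v, |indPass u v - indPass u' v|
      = |Real.smoothTransition u - Real.smoothTransition u'| := by
  wlog h : u' ≤ u generalizing u u'
  · rw [abs_sub_comm, ← this u' u (le_of_not_ge h)]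
    simp_rw [abs_sub_comm]
  · rw [abs_of_nonneg (sub_nonneg.2 (Real.smoothTransition.monotone h)), ← integral_indPass,
      ← integral_indPass, ← integral_sub (integrable_indPass _) (integrable_indPass _)]
    exact integral_congr_ae (ae_of_all _ fun v =>
      abs_of_nonneg (sub_nonneg.2 (indPass_mono h v)))

lemma abs_sum_indPass_sub_le (t : ℝ) (K : ℕ) (v : ℕ → unitInterval) :
    |∑ k ∈ Finset.range K, indPass (t - k) (v k) - max 0 (min t K)| ≤ 1 := by
  rw [← sum_clamp, ← Finset.sum_sub_distrib]
  refine (Finset.abs_sum_le_sum_abs _ _).trans ?_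
  have h : ∀ k ∈ Finset.range K, |indPass (t - k) (v k) - max 0 (min (t - k) 1)|
      ≤ if k = ⌊t⌋₊ then 1 else 0 := fun k _ => by
    have h0 := indPass_nonneg (t - k) (v k)
    have h1 := indPass_le_one (t - k) (v k)
    rcases le_or_gt (t - k) 0 with h | h
    · rw [indPass_of_nonpos h, max_eq_left ((min_le_left _ _).trans h)]
      split_ifs <;> simp
    rcases le_or_gt 1 (t - k) with h' | h'
    · rw [indPass_of_one_le h', min_eq_right h', max_eq_right zero_le_one]
      split_ifs <;> simp
    · have : k = ⌊t⌋₊ := ((Nat.floor_eq_iff (by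
        have : (0:ℝ) ≤ k := Nat.cast_nonneg k
        linarith)).2 ⟨by linarith, by linarith⟩).symm
      rw [if_pos this, min_eq_left h'.le, max_eq_right h.le, abs_le]
      constructor <;> linarith
  refine (Finset.sum_le_sum h).trans ?_
  rw [Finset.sum_ite_eq']
  split_ifs <;> norm_num

lemma exists_smoothTransition_lipschitz : ∃ C : ℝ, 0 ≤ C ∧ ∀ u u' : ℝ,
    |Real.smoothTransition u - Real.smoothTransition u'|
      ≤ C * |max 0 (min u 1) - max 0 (min u' 1)| := by
  obtain ⟨C, hC⟩ := (Real.smoothTransition.contDiff (n := 1)).contDiffOn.exists_lipschitzOnWith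
    one_ne_zero (convex_Icc (0:ℝ) 1) isCompact_Icc
  have hcl : ∀ u : ℝ, Real.smoothTransition u = Real.smoothTransition (max 0 (min u 1)) :=
    fun u => by
      rcases le_or_gt u 0 with h | h
      · rw [min_eq_left (by linarith), max_eq_left h, Real.smoothTransition.zero_of_nonpos h,
          Real.smoothTransition.zero]
      rcases le_or_gt u 1 with h' | h'
      · rw [min_eq_left h', max_eq_right h.le]
      · rw [min_eq_right h'.le, max_eq_right zero_le_one,
          Real.smoothTransition.one_of_one_le h'.le, Real.smoothTransition.one]
  have hmem : ∀ u : ℝ, max 0 (min u 1) ∈ Set.Icc (0:ℝ) 1 := fun u =>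
    ⟨le_max_left _ _, max_le zero_le_one (min_le_right _ _)⟩
  refine ⟨C, C.2, fun u u' => ?_⟩
  rw [hcl u, hcl u']
  have h := hC.dist_le_mul _ (hmem u) _ (hmem u')
  simpa [Real.dist_eq] using h

/-- A Lipschitz constant of the smooth transition function. -/
def transConst : ℝ := exists_smoothTransition_lipschitz.choose

lemma transConst_nonneg : 0 ≤ transConst := exists_smoothTransition_lipschitz.choose_spec.1

lemma sum_abs_smoothTransition_sub_le (t t' : ℝ) (K : ℕ) :
    ∑ k ∈ Finset.range K, |Real.smoothTransition (t - k) - Real.smoothTransition (t' - k)|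
      ≤ transConst * |t - t'| := by
  wlog h : t' ≤ t generalizing t t'
  · have := this t' t (le_of_not_ge h)
    simp_rw [abs_sub_comm t' t] at this
    simpa only [abs_sub_comm] using this
  calc _ ≤ ∑ k ∈ Finset.range K, transConst *
          (max 0 (min (t - k) 1) - max 0 (min (t' - k) 1)) := by
        refine Finset.sum_le_sum fun k _ => ?_
        refine (exists_smoothTransition_lipschitz.choose_spec.2 _ _).trans_eq ?_
        rw [abs_of_nonneg (sub_nonneg.2 (by gcongr))]
        rfl
    _ = transConst * (max 0 (min t K) - max 0 (min t' K)) := by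
        rw [← Finset.mul_sum, Finset.sum_sub_distrib, sum_clamp, sum_clamp]
    _ ≤ _ := by
        have := transConst_nonneg
        gcongr
        refine (le_abs_self _).trans ((abs_max_sub_max_le_max _ _ _ _).trans ?_)
        refine max_le (by simp) ((abs_min_sub_min_le_max _ _ _ _).trans ?_)
        simp

lemma abs_prod_sub_prod_le {ι : Type*} (s : Finset ι) {f g : ι → ℝ}
    (hf : ∀ i, 0 ≤ f i ∧ f i ≤ 1) (hg : ∀ i, 0 ≤ g i ∧ g i ≤ 1) :
    |∏ i ∈ s, f i - ∏ i ∈ s, g i| ≤ ∑ i ∈ s, |f i - g i| := by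
  classical
  induction s using Finset.induction_on with
  | empty => simp
  | insert a s ha ih =>
    rw [Finset.prod_insert ha, Finset.prod_insert ha, Finset.sum_insert ha]
    have hP0 : 0 ≤ ∏ i ∈ s, f i := Finset.prod_nonneg fun i _ => (hf i).1
    have hP1 : ∏ i ∈ s, f i ≤ 1 := Finset.prod_le_one (fun i _ => (hf i).1) fun i _ => (hf i).2
    have : f a * ∏ i ∈ s, f i - g a * ∏ i ∈ s, g i
        = (f a - g a) * ∏ i ∈ s, f i + g a * (∏ i ∈ s, f i - ∏ i ∈ s, g i) := by ring
    rw [this]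
    refine (abs_add_le _ _).trans ?_
    rw [abs_mul, abs_mul, abs_of_nonneg hP0, abs_of_nonneg (hg a).1]
    exact add_le_add (mul_le_of_le_one_right (abs_nonneg _) hP1)
      ((mul_le_of_le_one_left (abs_nonneg _) (hg a).2).trans ih)

/-- Number of cells in each coordinate direction. -/
abbrev gridSize (n : ℕ) : ℕ := 2 * (n + 1) ^ 2

/-- Index set of the grid of mesh `1 / (n + 1)` on `[-(n + 1), n + 1] ^ dd × Fin nN`. A point
is recorded by one decision per coordinate and threshold. -/
abbrev Cell (dd nN n : ℕ) := (Fin dd × Fin (gridSize n) → Bool) × Fin nN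

/-- The randomness used for rounding a point to the grid. -/
abbrev Noise (dd n : ℕ) := Fin dd × Fin (gridSize n) → unitInterval

/-- Position of `x` relative to the `k`-th threshold, in units of the mesh. -/
def level (n : ℕ) (x : ℝ) (k : ℕ) : ℝ := (n + 1) * (x + (n + 1)) - k

/-- The random cell to which the point `y` is rounded. -/
def roundCell {dd nN : ℕ} (n : ℕ) (y : S dd nN) (V : Noise dd n) : Cell dd nN n :=
  (fun a => passes (level n (y.1 a.1) a.2) (V a), y.2)

/-- The grid point of a cell. -/
def gridPoint {dd nN : ℕ} (n : ℕ) (j : Cell dd nN n) : S dd nN :=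
  (fun i => (∑ k, if j.1 (i, k) then (1:ℝ) else 0) / (n + 1) - (n + 1), j.2)

/-- Probability that `y` is rounded to the cell `j`. -/
def cellWeight {dd nN : ℕ} (n : ℕ) (j : Cell dd nN n) (y : S dd nN) : ℝ :=
  if y.2 = j.2 then ∏ a, (if j.1 a then Real.smoothTransition (level n (y.1 a.1) a.2)
    else 1 - Real.smoothTransition (level n (y.1 a.1) a.2)) else 0

lemma measurable_roundCell {dd nN : ℕ} (n : ℕ) :
    Measurable (fun z : S dd nN × Noise dd n => roundCell n z.1 z.2) := by
  refine Measurable.prodMk (measurable_pi_lambda _ fun a => ?_) (by fun_prop)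
  have h : Measurable (fun z : S dd nN × Noise dd n => level n (z.1.1 a.1) a.2) := by
    unfold level
    fun_prop
  exact measurable_passes.comp (h.prodMk (by fun_prop))

lemma gridPoint_roundCell_apply {dd nN : ℕ} (n : ℕ) (y : S dd nN) (V : Noise dd n)
    (i : Fin dd) : (gridPoint n (roundCell n y V)).1 i
      = (∑ k : Fin (gridSize n), indPass (level n (y.1 i) k) (V (i, k))) / (n + 1) - (n + 1) :=
  rfl

lemma volume_roundCell_eq {dd nN : ℕ} (n : ℕ) (j : Cell dd nN n) (y : S dd nN) :
    (volume : Measure (Noise dd n)) {V | roundCell n y V = j}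
      = ENNReal.ofReal (cellWeight n j y) := by
  unfold cellWeight
  split_ifs with h
  · have hset : {V : Noise dd n | roundCell n y V = j}
        = Set.univ.pi fun a => {v | passes (level n (y.1 a.1) a.2) v = j.1 a} := by
      ext V
      simp only [roundCell, Prod.ext_iff, h, and_true, Set.mem_ofPred_eq, Set.mem_univ_pi,
        funext_iff]
    rw [hset, volume_pi, Measure.pi_pi, ENNReal.ofReal_prod_of_nonneg]
    · refine Finset.prod_congr rfl fun a _ => ?_
      cases hj : j.1 a
      · simpa using volume_not_passes _
      · simpa using volume_passes _
    · intro a _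
      split_ifs
      · exact Real.smoothTransition.nonneg _
      · exact sub_nonneg.2 (Real.smoothTransition.le_one _)
  · have hset : {V : Noise dd n | roundCell n y V = j} = ∅ := by
      ext V
      simp only [roundCell, Prod.ext_iff, h, and_false, Set.mem_ofPred_eq, Set.mem_empty_iff_false]
    simp [hset]

lemma cellFactor_mem {b : Bool} (u : ℝ) :
    0 ≤ (if b then Real.smoothTransition u else 1 - Real.smoothTransition u) ∧
      (if b then Real.smoothTransition u else 1 - Real.smoothTransition u) ≤ 1 := by
  have h0 := Real.smoothTransition.nonneg u
  have h1 := Real.smoothTransition.le_one u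
  split_ifs <;> constructor <;> linarith

lemma cellWeight_nonneg {dd nN : ℕ} (n : ℕ) (j : Cell dd nN n) (y : S dd nN) :
    0 ≤ cellWeight n j y := by
  unfold cellWeight
  split_ifs
  · exact Finset.prod_nonneg fun a _ => (cellFactor_mem _).1
  · exact le_rfl

lemma cellWeight_le_one {dd nN : ℕ} (n : ℕ) (j : Cell dd nN n) (y : S dd nN) :
    cellWeight n j y ≤ 1 := by
  unfold cellWeight
  split_ifs
  · exact Finset.prod_le_one (fun a _ => (cellFactor_mem _).1) fun a _ => (cellFactor_mem _).2
  · exact zero_le_one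

lemma contDiff_cellWeight {dd nN : ℕ} (n : ℕ) (j : Cell dd nN n) (i : Fin nN) :
    ContDiff ℝ (⊤ : ℕ∞) (fun x => cellWeight n j (x, i)) := by
  unfold cellWeight
  by_cases h : i = j.2
  · simp only [h, if_true]
    refine contDiff_prod fun a _ => ?_
    have h1 : ContDiff ℝ (⊤ : ℕ∞) (fun x : Fin dd → ℝ =>
        Real.smoothTransition (level n (x a.1) a.2)) := by
      refine Real.smoothTransition.contDiff.comp ?_
      unfold level
      fun_prop
    split_ifs
    · exact h1
    · exact contDiff_const.sub h1
  · simp only [h, if_false]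
    exact contDiff_const

lemma measurable_cellWeight {dd nN : ℕ} (n : ℕ) (j : Cell dd nN n) :
    Measurable (cellWeight n j) :=
  measurable_from_prod_countable_left fun i => (contDiff_cellWeight n j i).continuous.measurable

lemma integrable_cellWeight {dd nN : ℕ} (n : ℕ) (j : Cell dd nN n)
    (m : Measure (S dd nN)) [IsFiniteMeasure m] : Integrable (cellWeight n j) m := by
  refine (integrable_const (1:ℝ)).mono' (measurable_cellWeight n j).aestronglyMeasurable
    (ae_of_all _ fun y => ?_)
  rw [Real.norm_of_nonneg (cellWeight_nonneg _ _ _)]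
  exact cellWeight_le_one _ _ _

lemma sum_abs_level_sub_le {dd nN n : ℕ} (y y' : S dd nN) (i : Fin dd) :
    ∑ k : Fin (gridSize n), |Real.smoothTransition (level n (y.1 i) k)
      - Real.smoothTransition (level n (y'.1 i) k)|
      ≤ transConst * (n + 1) * Sdist y y' := by
  rw [Fin.sum_univ_eq_sum_range (fun k => |Real.smoothTransition (level n (y.1 i) k)
      - Real.smoothTransition (level n (y'.1 i) k)|)]
  refine (sum_abs_smoothTransition_sub_le _ _ _).trans ?_
  rw [← mul_sub, abs_mul, abs_of_nonneg (by positivity : (0:ℝ) ≤ n + 1), mul_assoc]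
  have := transConst_nonneg
  gcongr
  have h1 : y.1 i + ((n:ℝ) + 1) - (y'.1 i + (n + 1)) = (y.1 - y'.1) i := by simp
  rw [h1]
  exact (norm_le_pi_norm (y.1 - y'.1) i).trans (norm_sub_le_Sdist y y')

lemma abs_cellWeight_sub_le {dd nN : ℕ} (n : ℕ) (j : Cell dd nN n) (y y' : S dd nN) :
    |cellWeight n j y - cellWeight n j y'|
      ≤ (1 + dd * (transConst * (n + 1))) * Sdist y y' := by
  have hC := transConst_nonneg
  have hS := Sdist_nonneg y y'
  by_cases hm : y.2 = y'.2
  · unfold cellWeight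
    rw [hm]
    split_ifs with h
    · refine (abs_prod_sub_prod_le _ (fun a => cellFactor_mem _)
        fun a => cellFactor_mem _).trans ?_
      calc _ = ∑ a : Fin dd × Fin (gridSize n), |Real.smoothTransition (level n (y.1 a.1) a.2)
              - Real.smoothTransition (level n (y'.1 a.1) a.2)| := by
            refine Finset.sum_congr rfl fun a _ => ?_
            split_ifs
            · rfl
            · rw [sub_sub_sub_cancel_left, abs_sub_comm]
        _ ≤ ∑ _i : Fin dd, transConst * (n + 1) * Sdist y y' := by
            rw [Fintype.sum_prod_type]
            exact Finset.sum_le_sum fun i _ => sum_abs_level_sub_le y y' i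
        _ ≤ _ := by
            simp only [Finset.sum_const, Finset.card_univ, Fintype.card_fin, nsmul_eq_mul]
            nlinarith
    · simp only [sub_self, abs_zero]; positivity
  · have h1 : 1 ≤ Sdist y y' := by
      unfold Sdist
      rw [if_neg hm]
      linarith [norm_nonneg (y.1 - y'.1)]
    have h2 : |cellWeight n j y - cellWeight n j y'| ≤ 1 := by
      have := cellWeight_nonneg n j y
      have := cellWeight_nonneg n j y'
      have := cellWeight_le_one n j y
      have := cellWeight_le_one n j y'
      rw [abs_le]; constructor <;> linarith
    have h3 : 0 ≤ dd * (transConst * (n + 1)) := by positivity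
    nlinarith

lemma Sdist_gridPoint_roundCell_le {dd nN : ℕ} (n : ℕ) (y : S dd nN) (V : Noise dd n) :
    Sdist (gridPoint n (roundCell n y V)) y ≤ 1 / (n + 1) + max (‖y.1‖ - (n + 1)) 0 := by
  have hn : (0:ℝ) < n + 1 := by positivity
  have hmode : (gridPoint n (roundCell n y V)).2 = y.2 := rfl
  rw [Sdist, if_pos hmode, add_zero]
  refine (pi_norm_le_iff_of_nonneg (by positivity)).2 fun i => ?_
  rw [Pi.sub_apply, gridPoint_roundCell_apply]
  set x := y.1 i with hx
  set W : ℕ → unitInterval := fun k => if h : k < gridSize n then V (i, ⟨k, h⟩) else 0 with hW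
  have hsum : ∑ k : Fin (gridSize n), indPass (level n x k) (V (i, k))
      = ∑ k ∈ Finset.range (gridSize n), indPass ((n + 1) * (x + (n + 1)) - k) (W k) := by
    rw [← Fin.sum_univ_eq_sum_range
      (fun k => indPass (((n:ℝ) + 1) * (x + (n + 1)) - k) (W k))]
    refine Finset.sum_congr rfl fun k _ => ?_
    simp [hW, level]
  have h1 := abs_sum_indPass_sub_le ((n + 1) * (x + (n + 1))) (gridSize n) W
  rw [hsum]
  set A := ∑ k ∈ Finset.range (gridSize n), indPass (((n:ℝ) + 1) * (x + (n + 1)) - k) (W k)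
  have hK : ((gridSize n : ℕ) : ℝ) = (n + 1) * (2 * (n + 1)) := by push_cast; ring
  have hcl : max 0 (min ((n + 1) * (x + (n + 1))) ((gridSize n : ℕ) : ℝ))
      = (n + 1) * max 0 (min (x + (n + 1)) (2 * (n + 1))) := by
    rw [hK, ← mul_min_of_nonneg _ _ hn.le, mul_max_of_nonneg _ _ hn.le, mul_zero]
  rw [hcl] at h1
  set c := max 0 (min (x + ((n:ℝ) + 1)) (2 * (n + 1))) with hc
  have hA : |A / (n + 1) - c| ≤ 1 / (n + 1) := by
    rw [show A / (n + 1) - c = (A - (n + 1) * c) / (n + 1) by field_simp, abs_div,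
      abs_of_pos hn]
    gcongr
  have hxn : |x| ≤ ‖y.1‖ := norm_le_pi_norm y.1 i
  have hcx : |c - (n + 1) - x| ≤ max (‖y.1‖ - (n + 1)) 0 := by
    have hx1 := abs_le.1 hxn
    rcases le_total (x + ((n:ℝ) + 1)) 0 with h | h
    · rw [hc, min_eq_left (by linarith), max_eq_left h]
      refine le_max_of_le_left (abs_le.2 ⟨?_, ?_⟩) <;> linarith
    rcases le_total (x + ((n:ℝ) + 1)) (2 * (n + 1)) with h' | h'
    · rw [hc, min_eq_left h', max_eq_right h]
      refine le_max_of_le_right (le_of_eq ?_)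
      rw [abs_eq_zero]; ring
    · rw [hc, min_eq_right h', max_eq_right (by linarith)]
      refine le_max_of_le_left (abs_le.2 ⟨?_, ?_⟩) <;> linarith
  have hsplit : A / (n + 1) - (n + 1) - x = (A / (n + 1) - c) + (c - (n + 1) - x) := by ring
  rw [Real.norm_eq_abs, hsplit]
  exact (abs_add_le _ _).trans (add_le_add hA hcx)

lemma measurable_level_indPass {dd n : ℕ} (u : ℝ) (a : Fin dd × Fin (gridSize n)) :
    Measurable (fun V : Noise dd n => indPass u (V a)) :=
  measurable_indPass.comp (by fun_prop : Measurable fun V : Noise dd n => (u, V a))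

lemma integral_abs_indPass_noise {dd n : ℕ} (u u' : ℝ) (a : Fin dd × Fin (gridSize n)) :
    ∫ V : Noise dd n, |indPass u (V a) - indPass u' (V a)|
      = |Real.smoothTransition u - Real.smoothTransition u'| := by
  rw [← integral_abs_indPass_sub u u']
  have hmp : MeasurePreserving (fun V : Noise dd n => V a) volume volume :=
    measurePreserving_eval (fun _ => (volume : Measure unitInterval)) a
  have hm : ∀ u, Measurable (indPass u) := fun u =>
    measurable_indPass.comp (by fun_prop : Measurable fun v : unitInterval => (u, v))
  have hF : Measurable (fun v => |indPass u v - indPass u' v|) := ((hm u).sub (hm u')).abs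
  rw [← hmp.map_eq, integral_map hmp.measurable.aemeasurable hF.aestronglyMeasurable]

/-- The rounding of nearby points with common randomness stays close in the mean. -/
lemma integral_Sdist_gridPoint_le {dd nN : ℕ} (n : ℕ) (y y' : S dd nN) :
    ∫ V : Noise dd n, Sdist (gridPoint n (roundCell n y V)) (gridPoint n (roundCell n y' V))
      ≤ (1 + dd * transConst) * Sdist y y' := by
  have hn : (0:ℝ) < n + 1 := by positivity
  set e : ℝ := if y.2 = y'.2 then 0 else 1 with he
  set f : Fin dd → Fin (gridSize n) → Noise dd n → ℝ := fun i k V =>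
    |indPass (level n (y.1 i) k) (V (i, k)) - indPass (level n (y'.1 i) k) (V (i, k))| with hf
  have hfi : ∀ i k, Integrable (f i k) := fun i k => by
    refine (integrable_const (1:ℝ)).mono' ((measurable_level_indPass _ _).sub
      (measurable_level_indPass _ _)).abs.aestronglyMeasurable (ae_of_all _ fun V => ?_)
    rw [hf, Real.norm_of_nonneg (abs_nonneg _), abs_le]
    have h1 := indPass_nonneg (level n (y.1 i) k) (V (i, k))
    have h2 := indPass_nonneg (level n (y'.1 i) k) (V (i, k))
    have h3 := indPass_le_one (level n (y.1 i) k) (V (i, k))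
    have h4 := indPass_le_one (level n (y'.1 i) k) (V (i, k))
    constructor <;> linarith
  have hsi : Integrable (fun V => ∑ i, (∑ k, f i k V) / (n + 1)) :=
    integrable_finsetSum _ fun i _ => (integrable_finsetSum _ fun k _ => hfi i k).div_const _
  have hle : ∀ V : Noise dd n,
      Sdist (gridPoint n (roundCell n y V)) (gridPoint n (roundCell n y' V))
        ≤ (∑ i, (∑ k, f i k V) / (n + 1)) + e := fun V => by
    have hpos : ∀ i, 0 ≤ (∑ k, f i k V) / (n + 1) := fun i =>
      div_nonneg (Finset.sum_nonneg fun k _ => abs_nonneg _) hn.le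
    refine add_le_add ((pi_norm_le_iff_of_nonneg
      (Finset.sum_nonneg fun i _ => hpos i)).2 fun i => ?_) le_rfl
    refine le_trans ?_ (Finset.single_le_sum (fun i _ => hpos i) (Finset.mem_univ i))
    rw [Pi.sub_apply, gridPoint_roundCell_apply, gridPoint_roundCell_apply, sub_sub_sub_cancel_right,
      ← sub_div, ← Finset.sum_sub_distrib, Real.norm_eq_abs, abs_div, abs_of_pos hn]
    gcongr
    exact Finset.abs_sum_le_sum_abs _ _
  calc _ ≤ ∫ V : Noise dd n, ((∑ i, (∑ k, f i k V) / (n + 1)) + e) :=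
        integral_mono_of_nonneg (ae_of_all _ fun V => Sdist_nonneg _ _)
          (hsi.add (integrable_const _)) (ae_of_all _ hle)
    _ = (∑ i, (∑ k : Fin (gridSize n), |Real.smoothTransition (level n (y.1 i) k)
          - Real.smoothTransition (level n (y'.1 i) k)|) / (n + 1)) + e := by
        rw [integral_add hsi (integrable_const _), integral_finsetSum _ fun i _ =>
          (integrable_finsetSum _ fun k _ => hfi i k).div_const _]
        simp only [integral_const, probReal_univ, one_smul, integral_div]
        congr 1
        refine Finset.sum_congr rfl fun i _ => ?_
        rw [integral_finsetSum _ fun k _ => hfi i k]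
        simp only [hf, integral_abs_indPass_noise]
    _ ≤ (∑ _i : Fin dd, transConst * Sdist y y') + Sdist y y' := by
        refine add_le_add (Finset.sum_le_sum fun i _ => ?_) ?_
        · rw [div_le_iff₀ hn]
          exact (sum_abs_level_sub_le y y' i).trans_eq (by ring)
        · unfold Sdist; linarith [norm_nonneg (y.1 - y'.1)]
    _ = _ := by
        simp only [Finset.sum_const, Finset.card_univ, Fintype.card_fin, nsmul_eq_mul]
        ring

lemma map_roundCell_singleton {dd nN : ℕ} (n : ℕ) (m : ProbabilityMeasure (S dd nN))
    (j : Cell dd nN n) :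
    (((m : Measure (S dd nN)).prod (volume : Measure (Noise dd n))).map
      fun z => roundCell n z.1 z.2) {j}
      = ENNReal.ofReal (∫ y, cellWeight n j y ∂(m : Measure (S dd nN))) := by
  have hj : MeasurableSet {z : S dd nN × Noise dd n | roundCell n z.1 z.2 = j} :=
    measurable_roundCell n (measurableSet_singleton j)
  rw [Measure.map_apply (measurable_roundCell n) (measurableSet_singleton j)]
  change ((m : Measure (S dd nN)).prod volume)
    {z : S dd nN × Noise dd n | roundCell n z.1 z.2 = j} = _
  rw [Measure.prod_apply hj, ofReal_integral_eq_lintegral_ofReal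
    (integrable_cellWeight n j _) (ae_of_all _ fun y => cellWeight_nonneg n j y)]
  exact lintegral_congr fun y => volume_roundCell_eq n j y

/-- The law of the random cell of a point with distribution `m`. -/
def cellLaw {dd nN : ℕ} (n : ℕ) (m : ProbabilityMeasure (S dd nN)) :
    stdSimplex ℝ (Cell dd nN n) :=
  ⟨fun j => ∫ y, cellWeight n j y ∂(m : Measure (S dd nN)),
    fun j => integral_nonneg fun y => cellWeight_nonneg n j y, by
    have hp : IsProbabilityMeasure (((m : Measure (S dd nN)).prod
        (volume : Measure (Noise dd n))).map fun z => roundCell n z.1 z.2) :=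
      Measure.isProbabilityMeasure_map (measurable_roundCell n).aemeasurable
    have h := hp.measure_univ
    rw [← Finset.coe_univ, ← sum_measure_singleton] at h
    simp only [map_roundCell_singleton] at h
    rw [← ENNReal.ofReal_sum_of_nonneg fun j _ =>
      integral_nonneg fun y => cellWeight_nonneg n j y] at h
    exact ENNReal.ofReal_eq_one.1 h⟩

/-- The rounding of a measure to the `n`-th grid. -/
def rounded {dd nN : ℕ} (n : ℕ) (m : ProbabilityMeasure (S dd nN)) :
    ProbabilityMeasure (S dd nN) :=
  disc (gridPoint n) (cellLaw n m)

/-- The random grid point to which a point is rounded. -/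
def roundPoint {dd nN : ℕ} (n : ℕ) (y : S dd nN) (V : Noise dd n) : S dd nN :=
  gridPoint n (roundCell n y V)

lemma measurable_roundPoint {dd nN : ℕ} (n : ℕ) :
    Measurable (fun z : S dd nN × Noise dd n => roundPoint n z.1 z.2) :=
  (measurable_of_finite (gridPoint n)).comp (measurable_roundCell n)

lemma _root_.Measurable.roundPoint {dd nN n : ℕ} {Ω : Type*} [MeasurableSpace Ω]
    {f : Ω → S dd nN} {V : Ω → Noise dd n} (hf : Measurable f) (hV : Measurable V) :
    Measurable fun w => roundPoint n (f w) (V w) := by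
  have h := (measurable_roundPoint n).comp (hf.prodMk hV)
  exact h

lemma map_roundPoint {dd nN : ℕ} (n : ℕ) (m : ProbabilityMeasure (S dd nN)) :
    ((m : Measure (S dd nN)).prod (volume : Measure (Noise dd n))).map
      (fun z => roundPoint n z.1 z.2) = (rounded n m : Measure (S dd nN)) := by
  have h : ((m : Measure (S dd nN)).prod (volume : Measure (Noise dd n))).map
      (fun z => roundCell n z.1 z.2) = discM id (cellLaw n m).1 := by
    rw [← Measure.sum_smul_dirac (Measure.map _ _), Measure.sum_fintype]
    simp only [map_roundCell_singleton]
    rfl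
  have hg : Measurable (gridPoint (dd := dd) (nN := nN) n) := measurable_of_finite _
  change Measure.map (gridPoint n ∘ fun z : S dd nN × Noise dd n => roundCell n z.1 z.2) _ = _
  rw [← Measure.map_map hg (measurable_roundCell n), h, map_discM hg]
  rfl

lemma map_roundPoint_of_map {dd nN : ℕ} (n : ℕ) {Ω : Type*} [MeasurableSpace Ω]
    {π : Measure Ω} [IsProbabilityMeasure π] {f : Ω → S dd nN} (hf : Measurable f)
    {m : ProbabilityMeasure (S dd nN)} (hm : π.map f = (m : Measure (S dd nN))) :
    (π.prod (volume : Measure (Noise dd n))).map (fun w => roundPoint n (f w.1) w.2)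
      = (rounded n m : Measure (S dd nN)) := by
  rw [← map_roundPoint, ← hm]
  have h := Measure.map_prod_map π (volume : Measure (Noise dd n)) hf measurable_id
  rw [Measure.map_id] at h
  rw [h, Measure.map_map (measurable_roundPoint n) (hf.prodMap measurable_id)]
  rfl

lemma hasMoment_rounded {dd nN : ℕ} (p : ℝ) (n : ℕ) (m : ProbabilityMeasure (S dd nN)) :
    HasMoment p (rounded n m) :=
  hasMoment_disc _ _ _

lemma cost_map {dd nN : ℕ} {Ω : Type*} [MeasurableSpace Ω] {P : Measure Ω} (p : ℝ)
    {f g : Ω → S dd nN} (hf : Measurable f) (hg : Measurable g) :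
    cost p (P.map fun w => (f w, g w)) = ∫ w, Sdist (f w) (g w) ^ p ∂P :=
  integral_map (hf.prodMk hg).aemeasurable
    (measurable_Sdist.pow_const p).aestronglyMeasurable

lemma isCoupling_map {dd nN : ℕ} {Ω : Type*} [MeasurableSpace Ω] {P : Measure Ω}
    [IsProbabilityMeasure P] {f g : Ω → S dd nN} (hf : Measurable f) (hg : Measurable g)
    {μ ν : ProbabilityMeasure (S dd nN)} (hμ : P.map f = (μ : Measure (S dd nN)))
    (hν : P.map g = (ν : Measure (S dd nN))) :
    IsCoupling (P.map fun w => (f w, g w)) μ ν := by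
  refine ⟨Measure.isProbabilityMeasure_map (hf.prodMk hg).aemeasurable, ?_, ?_⟩
  · rw [Measure.map_map measurable_fst (hf.prodMk hg)]; exact hμ
  · rw [Measure.map_map measurable_snd (hf.prodMk hg)]; exact hν

/-- Rounding is Lipschitz for the transport cost of order one, uniformly in the mesh. -/
lemma exists_coupling_rounded {dd nN : ℕ} (n : ℕ) {m m' : ProbabilityMeasure (S dd nN)}
    {π : Measure (S dd nN × S dd nN)} (hπ : IsCoupling π m m') (hm : HasMoment 1 m)
    (hm' : HasMoment 1 m') :
    ∃ ρ, IsCoupling ρ (rounded n m) (rounded n m') ∧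
      cost 1 ρ ≤ (1 + dd * transConst) * cost 1 π := by
  have := hπ.1
  have hf : Measurable fun w : (S dd nN × S dd nN) × Noise dd n => roundPoint n w.1.1 w.2 :=
    measurable_fst.fst.roundPoint measurable_snd
  have hg : Measurable fun w : (S dd nN × S dd nN) × Noise dd n => roundPoint n w.1.2 w.2 :=
    measurable_fst.snd.roundPoint measurable_snd
  have h1 := map_roundPoint_of_map n (π := π) measurable_fst hπ.2.1
  have h2 := map_roundPoint_of_map n (π := π) measurable_snd hπ.2.2
  have hρ := isCoupling_map hf hg h1 h2
  have hint := (hρ.integrable_cost zero_le_one (hasMoment_rounded 1 n m)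
    (hasMoment_rounded 1 n m')).comp_measurable (hf.prodMk hg)
  refine ⟨_, hρ, ?_⟩
  rw [cost_map 1 hf hg]
  have hci := hπ.integrable_cost zero_le_one hm hm'
  simp only [Function.comp_def, Real.rpow_one] at hint hci
  simp only [cost, Real.rpow_one]
  rw [integral_prod _ hint, ← integral_const_mul]
  exact integral_mono_of_nonneg
    (ae_of_all _ fun z => integral_nonneg fun V => Sdist_nonneg _ _) (hci.const_mul _)
    (ae_of_all _ fun z => integral_Sdist_gridPoint_le n z.1 z.2)

lemma Sdist_roundPoint_le {dd nN : ℕ} (n : ℕ) (y y' : S dd nN) (V : Noise dd n) :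
    Sdist (roundPoint n y V) y'
      ≤ 2 * Sdist y y' + 1 / (n + 1) + max (‖y'.1‖ - (n + 1)) 0 := by
  have h1 := Sdist_triangle (roundPoint n y V) y y'
  have h2 : Sdist (roundPoint n y V) y ≤ _ := Sdist_gridPoint_roundCell_le n y V
  have h3 : max (‖y.1‖ - ((n:ℝ) + 1)) 0 ≤ Sdist y y' + max (‖y'.1‖ - (n + 1)) 0 := by
    have h4 := norm_sub_le_Sdist y y'
    have h5 := norm_sub_norm_le y.1 y'.1
    have h6 := le_max_left (‖y'.1‖ - ((n:ℝ) + 1)) 0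
    have h7 := le_max_right (‖y'.1‖ - ((n:ℝ) + 1)) 0
    exact max_le (by linarith) (by linarith [Sdist_nonneg y y'])
  linarith

lemma integrable_tail {dd nN : ℕ} {p : ℝ} (hp : 0 ≤ p) {m : ProbabilityMeasure (S dd nN)}
    (hm : HasMoment p m) (n : ℕ) :
    Integrable (fun y : S dd nN => max (‖y.1‖ - ((n:ℝ) + 1)) 0 ^ p)
      (m : Measure (S dd nN)) := by
  refine Integrable.mono' hm (by fun_prop : Measurable
    fun y : S dd nN => max (‖y.1‖ - ((n:ℝ) + 1)) 0 ^ p).aestronglyMeasurable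
    (ae_of_all _ fun y => ?_)
  rw [Real.norm_of_nonneg (by positivity)]
  refine Real.rpow_le_rpow (le_max_right _ _) (max_le ?_ (norm_nonneg _)) hp
  have : (0:ℝ) ≤ n := Nat.cast_nonneg n
  linarith

lemma tendsto_tail {dd nN : ℕ} {p : ℝ} (hp : 0 < p) {m : ProbabilityMeasure (S dd nN)}
    (hm : HasMoment p m) :
    Tendsto (fun n : ℕ => ∫ y, max (‖y.1‖ - ((n:ℝ) + 1)) 0 ^ p ∂(m : Measure (S dd nN)))
      atTop (𝓝 0) := by
  have h := tendsto_integral_of_dominated_convergence (μ := (m : Measure (S dd nN)))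
    (F := fun (n : ℕ) y => max (‖y.1‖ - ((n:ℝ) + 1)) 0 ^ p) (f := fun _ => 0)
    (fun y => ‖y.1‖ ^ p) (fun n => (integrable_tail hp.le hm n).aestronglyMeasurable) hm
    (fun n => ae_of_all _ fun y => ?_) (ae_of_all _ fun y => ?_)
  · simpa using h
  · rw [Real.norm_of_nonneg (by positivity)]
    refine Real.rpow_le_rpow (le_max_right _ _) (max_le ?_ (norm_nonneg _)) hp.le
    have : (0:ℝ) ≤ n := Nat.cast_nonneg n
    linarith
  · obtain ⟨N, hN⟩ := exists_nat_ge ‖y.1‖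
    refine tendsto_const_nhds.congr' ?_
    filter_upwards [eventually_ge_atTop N] with n hn
    have : (N:ℝ) ≤ n := by exact_mod_cast hn
    rw [max_eq_right (by linarith), Real.zero_rpow hp.ne']

lemma exists_coupling_rounded_left {dd nN : ℕ} {p : ℝ} (hp : 0 ≤ p) (n : ℕ)
    {m m' : ProbabilityMeasure (S dd nN)} {π : Measure (S dd nN × S dd nN)}
    (hπ : IsCoupling π m m') (hm : HasMoment p m) (hm' : HasMoment p m') :
    ∃ ρ, IsCoupling ρ (rounded n m) m' ∧
      cost p ρ ≤ 3 ^ p * (2 ^ p * cost p π + (1 / ((n:ℝ) + 1)) ^ p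
        + ∫ y, max (‖y.1‖ - ((n:ℝ) + 1)) 0 ^ p ∂(m' : Measure (S dd nN))) := by
  have := hπ.1
  have hf : Measurable fun w : (S dd nN × S dd nN) × Noise dd n => roundPoint n w.1.1 w.2 :=
    measurable_fst.fst.roundPoint measurable_snd
  have hg : Measurable fun w : (S dd nN × S dd nN) × Noise dd n => w.1.2 := by fun_prop
  have hsnd : (π.prod (volume : Measure (Noise dd n))).map (fun w => w.1.2)
      = (m' : Measure (S dd nN)) := by
    rw [← hπ.2.2]
    change Measure.map (Prod.snd ∘ Prod.fst) _ = _
    rw [← Measure.map_map measurable_snd measurable_fst, Measure.map_fst_prod]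
    simp
  have hfst := map_roundPoint_of_map n (π := π) measurable_fst hπ.2.1
  refine ⟨_, isCoupling_map hf hg hfst hsnd, ?_⟩
  rw [cost_map p hf hg]
  set b : S dd nN × S dd nN → ℝ := fun z => 3 ^ p * (2 ^ p * Sdist z.1 z.2 ^ p
    + (1 / ((n:ℝ) + 1)) ^ p + max (‖z.2.1‖ - ((n:ℝ) + 1)) 0 ^ p) with hb
  have hi1 := (hπ.integrable_cost hp hm hm').const_mul (2 ^ p)
  have hi2 := hπ.integrable_snd (integrable_tail hp hm' n)
  have hi12 : Integrable (fun z : S dd nN × S dd nN => 2 ^ p * Sdist z.1 z.2 ^ p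
    + (1 / ((n:ℝ) + 1)) ^ p) π := hi1.add (integrable_const _)
  have hbi : Integrable b π := (hi12.add hi2).const_mul _
  calc _ ≤ ∫ w, b w.1 ∂(π.prod (volume : Measure (Noise dd n))) := by
        refine integral_mono_of_nonneg
          (ae_of_all _ fun w => Real.rpow_nonneg (Sdist_nonneg _ _) _)
          (hbi.comp_fst _) (ae_of_all _ fun w => ?_)
        have hS := Sdist_nonneg w.1.1 w.1.2
        refine (Real.rpow_le_rpow (Sdist_nonneg _ _) (Sdist_roundPoint_le n _ _ _) hp).trans ?_
        refine (rpow_add_three_le hp (by positivity) (by positivity)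
          (le_max_right _ _)).trans_eq ?_
        rw [Real.mul_rpow zero_le_two hS]
    _ = ∫ z, b z ∂π := by
        rw [integral_fun_fst]; simp
    _ = _ := by
        simp only [hb]
        rw [integral_const_mul, integral_add hi12 hi2, integral_add hi1 (integrable_const _),
          integral_const_mul, hπ.integral_snd (integrable_tail hp hm' n)]
        simp [cost]

/-- Rounding along finer and finer grids is compatible with Wasserstein convergence. -/
lemma tendsto_Wp_rounded {dd nN : ℕ} {p : ℝ} (hp : 0 < p)
    {ms : ℕ → ProbabilityMeasure (S dd nN)} {m : ProbabilityMeasure (S dd nN)}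
    (hms : ∀ k, HasMoment p (ms k)) (hm : HasMoment p m)
    (h : Tendsto (fun k => Wp Sdist p (ms k) m) atTop (𝓝 0))
    {ns : ℕ → ℕ} (hns : Tendsto ns atTop atTop) :
    Tendsto (fun k => Wp Sdist p (rounded (ns k) (ms k)) m) atTop (𝓝 0) := by
  obtain ⟨π, hπ, hc⟩ := exists_couplings_of_tendsto hp h
  choose ρ hρ hle using fun k =>
    exists_coupling_rounded_left hp.le (ns k) (hπ k) (hms k) hm
  refine tendsto_Wp_of_couplings hp hρ (squeeze_zero (fun k => cost_nonneg _ _) hle ?_)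
  have h1 : Tendsto (fun k => (1 / ((ns k : ℝ) + 1)) ^ p) atTop (𝓝 0) := by
    have := (tendsto_one_div_add_atTop_nhds_zero_nat (𝕜 := ℝ)).rpow_const (p := p)
      (Or.inr hp.le)
    rw [Real.zero_rpow hp.ne'] at this
    exact this.comp hns
  have h2 := (((hc.const_mul (2 ^ p)).add h1).add ((tendsto_tail hp hm).comp hns)).const_mul
    ((3:ℝ) ^ p)
  simpa using h2

/-- Sequential continuity for the `p`-Wasserstein distance on measures of finite `p`-th
moment. -/
def WpContinuous {dd nN : ℕ} (p : ℝ) (U : ProbabilityMeasure (S dd nN) → ℝ) : Prop :=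
  ∀ m : ProbabilityMeasure (S dd nN), HasMoment p m →
    ∀ ms : ℕ → ProbabilityMeasure (S dd nN), (∀ n, HasMoment p (ms n)) →
      Tendsto (fun n => Wp Sdist p (ms n) m) atTop (𝓝 0) →
      Tendsto (fun n => U (ms n)) atTop (𝓝 (U m))

lemma WpContinuous.continuous_disc {J : Type*} [Fintype J] {dd nN : ℕ} {p : ℝ} (hp : 0 < p)
    {U : ProbabilityMeasure (S dd nN) → ℝ} (hU : WpContinuous p U) (x : J → S dd nN) :
    Continuous fun q : stdSimplex ℝ J => U (disc x q) :=
  continuous_iff_seqContinuous.2 fun qs q hq =>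
    hU _ (hasMoment_disc p x q) _ (fun k => hasMoment_disc p x (qs k)) (tendsto_Wp_disc hp x hq)

/-- Smooth approximation of a continuous function on a possibly empty simplex. -/
lemma exists_smooth_approx_disc {J : Type*} [Fintype J] {dd nN : ℕ} {p : ℝ} (hp : 0 < p)
    {U : ProbabilityMeasure (S dd nN) → ℝ} (hU : WpContinuous p U) (x : J → S dd nN)
    {η : ℝ} (hη : 0 < η) :
    ∃ g : (J → ℝ) → ℝ, ContDiff ℝ (⊤ : ℕ∞) g ∧
      (∀ q : stdSimplex ℝ J, |g q.1 - U (disc x q)| ≤ η) ∧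
      ∀ (q q' : stdSimplex ℝ J) (B : ℝ),
        (∀ s ∈ Set.Icc (0:ℝ) 1, ∀ r v v' : stdSimplex ℝ J,
          v.1 = (fun j => s * q.1 j + (1 - s) * r.1 j) →
          v'.1 = (fun j => s * q'.1 j + (1 - s) * r.1 j) →
          |U (disc x v) - U (disc x v')| ≤ B) → |g q.1 - g q'.1| ≤ B := by
  rcases isEmpty_or_nonempty J with h | h
  · have hemp : stdSimplex ℝ J → False := fun q => by simpa using q.2.2
    exact ⟨0, contDiff_const, fun q => (hemp q).elim, fun q => (hemp q).elim⟩
  · exact exists_smooth_approx_simplex (hU.continuous_disc hp x) hη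

lemma smoothAllOrders_cellLaw {dd nN n : ℕ} {g : (Cell dd nN n → ℝ) → ℝ}
    (hg : ContDiff ℝ (⊤ : ℕ∞) g) :
    SmoothAllOrders (fun m : ProbabilityMeasure (S dd nN) => g (cellLaw n m).1) :=
  smoothAllOrders_cylinder hg (fun j _ => integrable_cellWeight n j _)
    fun j i => contDiff_cellWeight n j i

lemma abs_integral_sub_le_cost {dd nN : ℕ} {C : ℝ} {f : S dd nN → ℝ}
    (hC : ∀ y y', |f y - f y'| ≤ C * Sdist y y') {m m' : ProbabilityMeasure (S dd nN)}
    (hf : Integrable f (m : Measure (S dd nN))) (hf' : Integrable f (m' : Measure (S dd nN)))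
    (hm : HasMoment 1 m) (hm' : HasMoment 1 m') {π : Measure (S dd nN × S dd nN)}
    (hπ : IsCoupling π m m') :
    |∫ y, f y ∂(m : Measure (S dd nN)) - ∫ y, f y ∂(m' : Measure (S dd nN))|
      ≤ C * cost 1 π := by
  have hci := hπ.integrable_cost zero_le_one hm hm'
  simp only [Real.rpow_one] at hci
  rw [← hπ.integral_fst hf, ← hπ.integral_snd hf',
    ← integral_sub (hπ.integrable_fst hf) (hπ.integrable_snd hf')]
  simp only [cost, Real.rpow_one]
  rw [← integral_const_mul]
  refine abs_integral_le_integral_abs.trans ?_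
  exact integral_mono_of_nonneg (ae_of_all _ fun z => abs_nonneg _) (hci.const_mul C)
    (ae_of_all _ fun z => hC _ _)

lemma wpContinuous_cellLaw {dd nN n : ℕ} {g : (Cell dd nN n → ℝ) → ℝ} (hg : Continuous g) :
    WpContinuous 1 (fun m : ProbabilityMeasure (S dd nN) => g (cellLaw n m).1) := by
  intro m hm ms hms h
  obtain ⟨π, hπ, hc⟩ := exists_couplings_of_tendsto one_pos h
  refine (hg.tendsto _).comp (tendsto_pi_nhds.2 fun j => ?_)
  rw [tendsto_iff_norm_sub_tendsto_zero]
  refine squeeze_zero (fun _ => norm_nonneg _) (fun k => abs_integral_sub_le_cost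
    (abs_cellWeight_sub_le n j) (integrable_cellWeight n j _) (integrable_cellWeight n j _)
    (hms k) hm (hπ k)) ?_
  simpa using hc.const_mul (1 + (dd:ℝ) * (transConst * (n + 1)))

lemma uniform_approx_on_seqCompact {dd nN : ℕ} {p : ℝ} (hp : 0 < p)
    {U : ProbabilityMeasure (S dd nN) → ℝ} (hU : WpContinuous p U)
    {Us : ℕ → ProbabilityMeasure (S dd nN) → ℝ}
    (hUs : ∀ n m, |Us n m - U (rounded n m)| ≤ 1 / ((n:ℝ) + 1))
    {K : Set (ProbabilityMeasure (S dd nN))} (hK : ∀ m ∈ K, HasMoment p m)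
    (hKc : SeqCompactIn (Wp Sdist p) K) {ε : ℝ} (hε : 0 < ε) :
    ∃ N : ℕ, ∀ n ≥ N, ∀ m ∈ K, |Us n m - U m| ≤ ε := by
  by_contra! hcon
  choose ns hns ms hmK hlt using hcon
  obtain ⟨q, hq, φ, hφ, hlim⟩ := hKc ms hmK
  have hnφ : Tendsto (fun k => ns (φ k)) atTop atTop :=
    (tendsto_atTop_mono hns tendsto_id).comp hφ.tendsto_atTop
  have h1 : Tendsto (fun k => U (ms (φ k))) atTop (𝓝 (U q)) :=
    hU q (hK q hq) _ (fun k => hK _ (hmK _)) hlim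
  have h2 : Tendsto (fun k => U (rounded (ns (φ k)) (ms (φ k)))) atTop (𝓝 (U q)) :=
    hU q (hK q hq) _ (fun k => hasMoment_rounded p _ _)
      (tendsto_Wp_rounded hp (fun k => hK _ (hmK _)) (hK q hq) hlim hnφ)
  have h3 : Tendsto (fun k => 1 / ((ns (φ k) : ℝ) + 1)
      + |U (rounded (ns (φ k)) (ms (φ k))) - U (ms (φ k))|) atTop (𝓝 0) := by
    simpa using (tendsto_one_div_add_atTop_nhds_zero_nat (𝕜 := ℝ) |>.comp hnφ).add
      (h2.sub h1).abs
  obtain ⟨k, hk⟩ := (h3.eventually_lt_const hε).exists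
  have h4 := abs_sub_le (Us (ns (φ k)) (ms (φ k))) (U (rounded (ns (φ k)) (ms (φ k))))
    (U (ms (φ k)))
  linarith [hUs (ns (φ k)) (ms (φ k)), hlt (φ k)]

/-- The mollification of a continuous function: smooth cylinder functions of the rounded
measures. -/
lemma exists_mollification {dd nN : ℕ} {p : ℝ} (hp : 0 < p)
    {U : ProbabilityMeasure (S dd nN) → ℝ} (hU : WpContinuous p U) :
    ∃ Us : ℕ → ProbabilityMeasure (S dd nN) → ℝ,
      (∀ n, SmoothAllOrders (Us n)) ∧ (∀ n, WpContinuous 1 (Us n)) ∧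
      (∀ n m, |Us n m - U (rounded n m)| ≤ 1 / ((n:ℝ) + 1)) ∧
      ∀ n m m' B, (∀ s ∈ Set.Icc (0:ℝ) 1, ∀ r v v' : stdSimplex ℝ (Cell dd nN n),
        v.1 = (fun j => s * (cellLaw n m).1 j + (1 - s) * r.1 j) →
        v'.1 = (fun j => s * (cellLaw n m').1 j + (1 - s) * r.1 j) →
        |U (disc (gridPoint n) v) - U (disc (gridPoint n) v')| ≤ B) →
        |Us n m - Us n m'| ≤ B := by
  choose g hg hclose hlip using fun n : ℕ => exists_smooth_approx_disc hp hU
    (gridPoint (dd := dd) (nN := nN) n) (Nat.one_div_pos_of_nat (α := ℝ) (n := n))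
  exact ⟨fun n m => g n (cellLaw n m).1, fun n => smoothAllOrders_cellLaw (hg n),
    fun n => wpContinuous_cellLaw (hg n).continuous, fun n m => hclose n _,
    fun n m m' B h => hlip n _ _ B h⟩

lemma wpContinuous_of_lipschitz {dd nN : ℕ} {U : ProbabilityMeasure (S dd nN) → ℝ} {L : ℝ}
    (hU : ∀ m m' : ProbabilityMeasure (S dd nN), HasMoment 1 m → HasMoment 1 m' →
      |U m - U m'| ≤ L * Wp Sdist 1 m m') : WpContinuous 1 U := by
  intro m hm ms hms h
  rw [tendsto_iff_norm_sub_tendsto_zero]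
  exact squeeze_zero (fun _ => norm_nonneg _) (fun k => hU _ _ (hms k) hm)
    (by simpa using h.const_mul L)

lemma exists_mollification_lipschitz {dd nN : ℕ} {U : ProbabilityMeasure (S dd nN) → ℝ} {L : ℝ}
    (hU : ∀ m m' : ProbabilityMeasure (S dd nN), HasMoment 1 m → HasMoment 1 m' →
      |U m - U m'| ≤ L * Wp Sdist 1 m m') :
    ∃ Us : ℕ → ProbabilityMeasure (S dd nN) → ℝ,
      (∀ n, SmoothAllOrders (Us n)) ∧
      (∃ L' : ℝ, ∀ n (m m' : ProbabilityMeasure (S dd nN)), HasMoment 1 m → HasMoment 1 m' →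
        |Us n m - Us n m'| ≤ L' * Wp Sdist 1 m m') ∧
      ∀ n m, |Us n m - U (rounded n m)| ≤ 1 / ((n:ℝ) + 1) := by
  obtain ⟨Us, hs, -, hclose, hlip⟩ :=
    exists_mollification one_pos (wpContinuous_of_lipschitz hU)
  have hC := transConst_nonneg
  refine ⟨Us, hs, ⟨|L| * (1 + dd * transConst), fun n m m' hm hm' => ?_⟩, hclose⟩
  refine le_mul_Wp_one (by positivity) fun π hπ => ?_
  obtain ⟨ρ, hρ, hcρ⟩ := exists_coupling_rounded n hπ hm hm'
  refine hlip n m m' _ fun s hs r v v' hv hv' => ?_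
  obtain ⟨ρ', hρ', hcρ'⟩ := exists_coupling_combo (gridPoint n) hs hv hv' hρ
  calc _ ≤ L * Wp Sdist 1 (disc (gridPoint n) v) (disc (gridPoint n) v') :=
        hU _ _ (hasMoment_disc _ _ _) (hasMoment_disc _ _ _)
    _ ≤ |L| * Wp Sdist 1 (disc (gridPoint n) v) (disc (gridPoint n) v') :=
        mul_le_mul_of_nonneg_right (le_abs_self L) (Wp_nonneg _ _ _)
    _ ≤ |L| * ((1 + dd * transConst) * cost 1 π) :=
        mul_le_mul_of_nonneg_left
          ((Wp_one_le_of_coupling hρ').trans (hcρ'.trans hcρ)) (abs_nonneg L)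
    _ = _ := (mul_assoc _ _ _).symm

/-- Lemma 3.4, mollification on the Wasserstein space:
(i) every `W₂`-continuous `U : P₂(S) → ℝ` is a local uniform limit, on `W₂`-compact
sets, of functions in `C^∞(P₂(S))`;
(ii) every `W₁`-continuous `U : P₁(S) → ℝ` is a local uniform limit, on `W₁`-compact
sets, of functions in `C^∞(P₂(S)) ∩ C⁰(P₁(S))`;
(iii) if moreover `U` is `W₁`-Lipschitz, the approximating sequence can be chosen
`W₁`-Lipschitz uniformly in `n`. -/
theorem mollification_on_wasserstein {dd nN : ℕ} :
    -- (i)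
    (∀ U : ProbabilityMeasure (S dd nN) → ℝ,
      (∀ (m : ProbabilityMeasure (S dd nN)), FiniteSecondMoment m →
        ∀ ms : ℕ → ProbabilityMeasure (S dd nN), (∀ n, FiniteSecondMoment (ms n)) →
        Tendsto (fun n => W2S (ms n) m) atTop (𝓝 0) →
        Tendsto (fun n => U (ms n)) atTop (𝓝 (U m))) →
      ∃ Us : ℕ → ProbabilityMeasure (S dd nN) → ℝ,
        (∀ n, SmoothAllOrders (Us n)) ∧
        ∀ K : Set (ProbabilityMeasure (S dd nN)),
          (∀ m ∈ K, FiniteSecondMoment m) → SeqCompactIn W2S K →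
          ∀ ε > (0:ℝ), ∃ N : ℕ, ∀ n ≥ N, ∀ m ∈ K, |Us n m - U m| ≤ ε) ∧
    -- (ii)
    (∀ U : ProbabilityMeasure (S dd nN) → ℝ,
      (∀ (m : ProbabilityMeasure (S dd nN)), FiniteFirstMoment m →
        ∀ ms : ℕ → ProbabilityMeasure (S dd nN), (∀ n, FiniteFirstMoment (ms n)) →
        Tendsto (fun n => W1S (ms n) m) atTop (𝓝 0) →
        Tendsto (fun n => U (ms n)) atTop (𝓝 (U m))) →
      ∃ Us : ℕ → ProbabilityMeasure (S dd nN) → ℝ,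
        (∀ n, SmoothAllOrders (Us n)) ∧
        (∀ n (m : ProbabilityMeasure (S dd nN)), FiniteFirstMoment m →
          ∀ ms : ℕ → ProbabilityMeasure (S dd nN), (∀ k, FiniteFirstMoment (ms k)) →
          Tendsto (fun k => W1S (ms k) m) atTop (𝓝 0) →
          Tendsto (fun k => Us n (ms k)) atTop (𝓝 (Us n m))) ∧
        ∀ K : Set (ProbabilityMeasure (S dd nN)),
          (∀ m ∈ K, FiniteFirstMoment m) → SeqCompactIn W1S K →
          ∀ ε > (0:ℝ), ∃ N : ℕ, ∀ n ≥ N, ∀ m ∈ K, |Us n m - U m| ≤ ε) ∧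
    -- (iii)
    (∀ (U : ProbabilityMeasure (S dd nN) → ℝ) (L : ℝ),
      (∀ (m m' : ProbabilityMeasure (S dd nN)), FiniteFirstMoment m →
        FiniteFirstMoment m' → |U m - U m'| ≤ L * W1S m m') →
      ∃ Us : ℕ → ProbabilityMeasure (S dd nN) → ℝ,
        (∀ n, SmoothAllOrders (Us n)) ∧
        (∃ L' : ℝ, ∀ n (m m' : ProbabilityMeasure (S dd nN)), FiniteFirstMoment m →
          FiniteFirstMoment m' → |Us n m - Us n m'| ≤ L' * W1S m m') ∧
        ∀ K : Set (ProbabilityMeasure (S dd nN)),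
          (∀ m ∈ K, FiniteFirstMoment m) → SeqCompactIn W1S K →
          ∀ ε > (0:ℝ), ∃ N : ℕ, ∀ n ≥ N, ∀ m ∈ K, |Us n m - U m| ≤ ε) := by
  simp only [← hasMoment_two_iff, ← hasMoment_one_iff]
  refine ⟨fun U hU => ?_, fun U hU => ?_, fun U L hU => ?_⟩
  · obtain ⟨Us, hs, -, hclose, -⟩ := exists_mollification two_pos hU
    exact ⟨Us, hs, fun K hK hKc ε hε =>
      uniform_approx_on_seqCompact two_pos hU hclose hK hKc hε⟩
  · obtain ⟨Us, hs, hcont, hclose, -⟩ := exists_mollification one_pos hU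
    exact ⟨Us, hs, hcont, fun K hK hKc ε hε =>
      uniform_approx_on_seqCompact one_pos hU hclose hK hKc hε⟩
  · obtain ⟨Us, hs, hlip, hclose⟩ := exists_mollification_lipschitz hU
    exact ⟨Us, hs, hlip, fun K hK hKc ε hε =>
      uniform_approx_on_seqCompact one_pos (wpContinuous_of_lipschitz hU) hclose hK hKc hε⟩

end MFOS
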